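/- Let W=(w_{ij}) be a nonnegative real m×n matrix, let R_1,…,R_p be positive integer m-vectors and C_1,…,C_p be positive integer n-vectors with |R_1|=…=|R_p|=|C_1|=…=|C_p|=N, and let α_1,…,α_p ≥ 0 satisfy α_1+…+α_p=1. Suppose R = Σ_{k=1}^p α_k R_k and C = Σ_{k=1}^p α_k C_k are again positive integer vectors. Then (N^N/N!) · T(R,C;W)/(ω(R)ω(C)) ≥ ∏_{k=1}^p ( T(R_k,C_k;W) / min{ω(R_k), ω(C_k)} )^{α_k}. -/

import Mathlib

open scoped BigOperators

/-- The total weight `T(R,C;W)` of contingency tables with row sums `R`,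
column sums `C`, and weight `∏ W i j ^ D i j` (with the convention `0 ^ 0 = 1`). -/
noncomputable def tableWeight {m n : ℕ} (R : Fin m → ℕ) (C : Fin n → ℕ)
    (W : Fin m → Fin n → ℝ) : ℝ :=
  ∑' D : {D : Fin m → Fin n → ℕ //
      (∀ i, ∑ j, D i j = R i) ∧ (∀ j, ∑ i, D i j = C j)},
    ∏ i, ∏ j, W i j ^ D.1 i j

/-- `ω(B) = ∏ i, B i ^ (B i) / (B i)!` for a positive integer vector `B`. -/
noncomputable def omegaVec {l : ℕ} (B : Fin l → ℕ) : ℝ :=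
  ∏ i, ((B i : ℝ) ^ (B i)) / (Nat.factorial (B i) : ℝ)

section Stability

variable {ι σ : Type*}

theorem pderiv_comm (i j : σ) (q : MvPolynomial σ ℝ) :
    MvPolynomial.pderiv i (MvPolynomial.pderiv j q)
      = MvPolynomial.pderiv j (MvPolynomial.pderiv i q) := by
  classical
  ext d
  simp only [MvPolynomial.coeff_pderiv]
  by_cases h : i = j
  · subst h; rfl
  · have h' : j ≠ i := Ne.symm h
    simp [h, h', add_right_comm d]
    ring

theorem eval_eq_of_isHomogeneous_zero {q : MvPolynomial σ ℝ} (hq : q.IsHomogeneous 0)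
    (x y : σ → ℝ) : MvPolynomial.eval x q = MvPolynomial.eval y q := by
  rw [MvPolynomial.totalDegree_eq_zero_iff_eq_C.1 (Nat.le_zero.1 hq.totalDegree_le)]
  simp

/-- The restriction of a polynomial to the complex line `z + t v`. -/
noncomputable def lineRestrict (q : MvPolynomial σ ℝ) (z v : σ → ℂ) : Polynomial ℂ :=
  MvPolynomial.aeval (fun j => Polynomial.C (z j) + Polynomial.C (v j) * Polynomial.X) q

theorem eval_lineRestrict (q : MvPolynomial σ ℝ) (z v : σ → ℂ) (t : ℂ) :
    (lineRestrict q z v).eval t = MvPolynomial.aeval (fun j => z j + v j * t) q := by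
  have h := MvPolynomial.map_aeval
    (fun j => Polynomial.C (z j) + Polynomial.C (v j) * Polynomial.X) (Polynomial.evalRingHom t) q
  simp only [Polynomial.coe_evalRingHom] at h
  rw [lineRestrict, h, MvPolynomial.aeval_def]
  simp only [Polynomial.eval_add, Polynomial.eval_mul, Polynomial.eval_C, Polynomial.eval_X,
    MvPolynomial.coe_eval₂Hom]
  congr 1
  ext r
  simp [Polynomial.algebraMap_apply]

theorem aeval_smul_of_isHomogeneous {q : MvPolynomial σ ℝ} {k : ℕ} (hq : q.IsHomogeneous k)
    (c : ℂ) (z : σ → ℂ) :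
    MvPolynomial.aeval (fun j => c * z j) q = c ^ k * MvPolynomial.aeval z q := by
  rw [MvPolynomial.aeval_def, MvPolynomial.eval₂_eq, MvPolynomial.aeval_def,
    MvPolynomial.eval₂_eq, Finset.mul_sum]
  refine Finset.sum_congr rfl fun d hd => ?_
  have h := hq (MvPolynomial.mem_support_iff.1 hd)
  have h2 : ∑ j ∈ d.support, d j = k := by
    simpa [Finsupp.weight_apply, Finsupp.sum] using h
  simp only [mul_pow, Finset.prod_mul_distrib, Finset.prod_pow_eq_pow_sum, h2]
  ring

theorem aeval_ofReal (q : MvPolynomial σ ℝ) (v : σ → ℝ) :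
    MvPolynomial.aeval (fun j => (v j : ℂ)) q = ((MvPolynomial.eval v q : ℝ) : ℂ) := by
  have := MvPolynomial.map_aeval v (algebraMap ℝ ℂ) q
  simpa [MvPolynomial.aeval_def, MvPolynomial.eval₂_eq', MvPolynomial.eval_eq'] using this.symm

variable [Fintype σ]

/-- The derivative of a polynomial in the constant direction `v`. -/
noncomputable def dirDeriv (v : σ → ℝ) : Module.End ℝ (MvPolynomial σ ℝ) :=
  ∑ j, v j • (MvPolynomial.pderiv j : Derivation ℝ _ (MvPolynomial σ ℝ)).toLinearMap

theorem dirDeriv_apply (v : σ → ℝ) (q : MvPolynomial σ ℝ) :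
    dirDeriv v q = ∑ j, v j • MvPolynomial.pderiv j q := by
  simp [dirDeriv, LinearMap.sum_apply]

theorem dirDeriv_commute (v w : σ → ℝ) : Commute (dirDeriv v) (dirDeriv w) := by
  refine LinearMap.ext fun q => ?_
  simp only [Module.End.mul_apply, dirDeriv_apply, map_sum, map_smul, Finset.smul_sum]
  rw [Finset.sum_comm]
  refine Finset.sum_congr rfl fun i _ => Finset.sum_congr rfl fun j _ => ?_
  rw [smul_comm, pderiv_comm]

theorem dirDeriv_add_smul (v w : σ → ℝ) (t : ℝ) :
    dirDeriv (v + t • w) = dirDeriv v + t • dirDeriv w := by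
  simp [dirDeriv, add_smul, Finset.sum_add_distrib, Finset.smul_sum, mul_smul]

theorem dirDeriv_single [DecidableEq σ] (j : σ) (q : MvPolynomial σ ℝ) :
    dirDeriv (Pi.single j 1) q = MvPolynomial.pderiv j q := by
  rw [dirDeriv_apply, Finset.sum_eq_single j] <;> simp +contextual

theorem dirDeriv_isHomogeneous {q : MvPolynomial σ ℝ} {k : ℕ} (hq : q.IsHomogeneous (k + 1))
    (v : σ → ℝ) : (dirDeriv v q).IsHomogeneous k := by
  rw [dirDeriv_apply]
  refine MvPolynomial.IsHomogeneous.sum _ _ _ fun j _ => ?_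
  rw [MvPolynomial.smul_eq_C_mul]
  simpa using (MvPolynomial.isHomogeneous_C σ (v j)).mul hq.pderiv

theorem eval_dirDeriv_self {q : MvPolynomial σ ℝ} {k : ℕ} (hq : q.IsHomogeneous k)
    (y : σ → ℝ) : MvPolynomial.eval y (dirDeriv y q) = k * MvPolynomial.eval y q := by
  have h := congrArg (MvPolynomial.eval y) hq.sum_X_mul_pderiv
  simpa [dirDeriv_apply, MvPolynomial.smul_eval] using h

theorem eval_dirDeriv_pow_self (y x : σ → ℝ) {k : ℕ} : ∀ {q : MvPolynomial σ ℝ},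
    q.IsHomogeneous k →
    MvPolynomial.eval x ((dirDeriv y ^ k) q) = k.factorial * MvPolynomial.eval y q := by
  induction k with
  | zero =>
    intro q hq
    simpa using eval_eq_of_isHomogeneous_zero hq x y
  | succ k ih =>
    intro q hq
    rw [pow_succ, Module.End.mul_apply, ih (dirDeriv_isHomogeneous hq y),
      eval_dirDeriv_self hq, Nat.factorial_succ]
    push_cast; ring

theorem eval_add_smul_expansion (y e x : σ → ℝ) (t : ℝ) {k : ℕ} {q : MvPolynomial σ ℝ}
    (hq : q.IsHomogeneous k) :
    k.factorial * MvPolynomial.eval (y + t • e) q = ∑ i ∈ Finset.range (k + 1),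
      (k.choose i : ℝ) * t ^ i *
        MvPolynomial.eval x ((dirDeriv e ^ i) ((dirDeriv y ^ (k - i)) q)) := by
  rw [← eval_dirDeriv_pow_self (y + t • e) x hq, dirDeriv_add_smul, add_comm,
    ((dirDeriv_commute e y).smul_left t).add_pow, LinearMap.sum_apply, map_sum]
  refine Finset.sum_congr rfl fun i _ => ?_
  rw [← Nat.cast_comm, Module.End.mul_apply, smul_pow, Module.End.mul_apply, LinearMap.smul_apply,
    ← nsmul_eq_mul]
  simp [MvPolynomial.smul_eval]
  ring

/-- Homogeneous polynomials with nonnegative coefficients having no zeros in the tube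
`{z | ∀ i, 0 < Re (∑ j, a i j * z j)}`. -/
structure IsTubeStable (a : ι → σ → ℝ) (k : ℕ) (q : MvPolynomial σ ℝ) : Prop where
  hom : q.IsHomogeneous k
  coeff_nonneg : ∀ d, 0 ≤ q.coeff d
  ne_zero : ∀ z : σ → ℂ, (∀ i, 0 < (∑ j, a i j * z j).re) → MvPolynomial.aeval z q ≠ 0

/-- Directions pointing into the tube. -/
def IsTubeDir (a : ι → σ → ℝ) (v : σ → ℝ) : Prop :=
  (∀ j, 0 ≤ v j) ∧ ∀ i, 0 < ∑ j, a i j * v j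

theorem derivative_lineRestrict (q : MvPolynomial σ ℝ) (z : σ → ℂ) (v : σ → ℝ) :
    (lineRestrict q z (fun j => v j)).derivative
      = lineRestrict (dirDeriv v q) z (fun j => v j) := by
  classical
  unfold lineRestrict
  induction q using MvPolynomial.induction_on with
  | C r => simp [dirDeriv_apply, IsScalarTower.algebraMap_apply ℝ ℂ (Polynomial ℂ)]
  | add p q hp hq => simp [map_add, hp, hq]
  | mul_X p i hp =>
    have : dirDeriv v (p * MvPolynomial.X i)
        = dirDeriv v p * MvPolynomial.X i + MvPolynomial.C (v i) * p := by
      simp only [dirDeriv_apply, Finset.sum_mul]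
      have h1 : ∀ j, v j • MvPolynomial.pderiv j (p * MvPolynomial.X i)
          = v j • MvPolynomial.pderiv j p * MvPolynomial.X i
            + if j = i then MvPolynomial.C (v i) * p else 0 := by
        intro j
        rw [MvPolynomial.pderiv_mul]
        split_ifs with h
        · subst h
          simp [MvPolynomial.smul_eq_C_mul]; ring
        · simp [MvPolynomial.smul_eq_C_mul, Ne.symm h]; try ring
      rw [Finset.sum_congr rfl fun j _ => h1 j]
      simp [Finset.sum_add_distrib]
    rw [this]
    simp [hp, IsScalarTower.algebraMap_apply ℝ ℂ (Polynomial ℂ)]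
    ring

theorem IsTubeDir.re_pos {a : ι → σ → ℝ} {v : σ → ℝ} (hv : IsTubeDir a v) (i : ι) :
    0 < (∑ j, a i j * (v j : ℂ)).re := by
  simpa using hv.2 i

theorem IsTubeStable.eval_pos {a : ι → σ → ℝ} {k : ℕ} {q : MvPolynomial σ ℝ}
    (hq : IsTubeStable a k q) {v : σ → ℝ} (hv : IsTubeDir a v) :
    0 < MvPolynomial.eval v q := by
  refine lt_of_le_of_ne ?_ fun h => ?_
  · rw [MvPolynomial.eval_eq]
    exact Finset.sum_nonneg fun d _ => mul_nonneg (hq.coeff_nonneg d)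
      (Finset.prod_nonneg fun j _ => pow_nonneg (hv.1 j) _)
  · apply hq.ne_zero (fun j => v j) hv.re_pos
    rw [aeval_ofReal, ← h, Complex.ofReal_zero]

theorem IsTubeStable.dirDeriv {a : ι → σ → ℝ} {k : ℕ} {q : MvPolynomial σ ℝ}
    (hq : IsTubeStable a (k + 1) q) {v : σ → ℝ} (hv : IsTubeDir a v) :
    IsTubeStable a k (dirDeriv v q) := by
  refine ⟨dirDeriv_isHomogeneous hq.hom v, fun d => ?_, fun z hz h0 => ?_⟩
  · rw [dirDeriv_apply, MvPolynomial.coeff_sum]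
    refine Finset.sum_nonneg fun j _ => ?_
    rw [MvPolynomial.coeff_smul, MvPolynomial.coeff_pderiv]
    exact mul_nonneg (hv.1 j) (mul_nonneg (hq.coeff_nonneg _) (by positivity))
  · set f := lineRestrict q z (fun j => v j) with hf
    have hroot : ∀ t : ℂ, f.eval t = 0 → t.re < 0 := by
      intro t ht
      by_contra! hre
      rw [hf, eval_lineRestrict] at ht
      refine hq.ne_zero _ (fun i => ?_) ht
      have : (∑ j, (a i j : ℂ) * (z j + v j * t)).re
          = (∑ j, a i j * z j).re + (∑ j, a i j * v j) * t.re := by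
        simp [mul_add, Finset.sum_add_distrib, Finset.sum_mul, mul_assoc]
      rw [this]
      have := hz i
      have := hv.2 i
      positivity
    have hder : f.derivative.eval 0 = 0 := by
      rw [hf, derivative_lineRestrict, eval_lineRestrict]
      simpa using h0
    have hdeg : 0 < f.degree := by
      by_contra! hd
      obtain ⟨c, hc⟩ : ∃ c, f = Polynomial.C c := ⟨_, Polynomial.eq_C_of_degree_le_zero hd⟩
      set g := lineRestrict q (fun j => v j) z with hg
      have hgc : g = Polynomial.C c * Polynomial.X ^ (k + 1) := by
        refine Polynomial.eq_of_infinite_eval_eq _ _ ?_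
        refine Set.Infinite.mono (s := {0}ᶜ) (fun s hs => ?_)
          (Set.Finite.infinite_compl (Set.finite_singleton 0))
        have hs' : s ≠ 0 := hs
        have h1 : f.eval s⁻¹ = c := by rw [hc]; simp
        rw [hf, eval_lineRestrict] at h1
        have h2 := aeval_smul_of_isHomogeneous hq.hom s (fun j => z j + v j * s⁻¹)
        rw [h1] at h2
        simp only [Set.mem_ofPred_eq, hg, eval_lineRestrict, Polynomial.eval_mul,
          Polynomial.eval_C, Polynomial.eval_pow, Polynomial.eval_X]
        rw [mul_comm c, ← h2]
        congr 2
        funext j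
        field_simp
        ring
      have h3 : g.eval 0 = 0 := by rw [hgc]; simp
      rw [hg, eval_lineRestrict] at h3
      exact hq.ne_zero _ hv.re_pos (by simpa using h3)
    have hmem : (0 : ℂ) ∈ f.derivative.rootSet ℂ := by
      rw [Polynomial.mem_rootSet]
      refine ⟨fun h => ?_, by simpa using hder⟩
      rw [Polynomial.derivative_eq_zero] at h
      exact hdeg.not_ge (Polynomial.natDegree_eq_zero_iff_degree_le_zero.1 h)
    have hsub := Polynomial.rootSet_derivative_subset_convexHull_rootSet hdeg hmem
    have hhalf : convexHull ℝ (f.rootSet ℂ) ⊆ {t : ℂ | t.re < 0} := by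
      refine convexHull_min (fun t ht => hroot t ?_) (convex_halfSpace_re_lt 0)
      simpa using (Polynomial.mem_rootSet.1 ht).2
    have hlt := hhalf hsub
    simp at hlt

theorem IsTubeStable.dirDeriv_pow {a : ι → σ → ℝ} {k : ℕ} {v : σ → ℝ} (hv : IsTubeDir a v)
    (i : ℕ) : ∀ {q : MvPolynomial σ ℝ}, IsTubeStable a (k + i) q →
    IsTubeStable a k ((_root_.dirDeriv v ^ i) q) := by
  induction i with
  | zero => intro q hq; simpa using hq
  | succ i ih =>
    intro q hq
    rw [pow_succ, Module.End.mul_apply]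
    exact ih (IsTubeStable.dirDeriv (k := k + i) hq hv)

theorem IsTubeStable.quadratic_inequality {a : ι → σ → ℝ} {q : MvPolynomial σ ℝ}
    (hq : IsTubeStable a 2 q) {v w : σ → ℝ} (hv : IsTubeDir a v) (hw : IsTubeDir a w) :
    MvPolynomial.eval 0 ((_root_.dirDeriv v ^ 2) q) * MvPolynomial.eval 0 ((_root_.dirDeriv w ^ 2) q)
      ≤ MvPolynomial.eval 0 (_root_.dirDeriv v (_root_.dirDeriv w q)) ^ 2 := by
  set A := MvPolynomial.eval 0 ((_root_.dirDeriv v ^ 2) q) with hA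
  set B := MvPolynomial.eval 0 (_root_.dirDeriv v (_root_.dirDeriv w q)) with hB
  set D := MvPolynomial.eval 0 ((_root_.dirDeriv w ^ 2) q) with hD
  have hApos : 0 < A := by
    have := eval_dirDeriv_pow_self v 0 hq.hom
    rw [hA, this]
    have := hq.eval_pos hv
    positivity
  have hreal : ∀ t : ℝ, 2 * MvPolynomial.eval (w + t • v) q = D + 2 * B * t + A * t ^ 2 := by
    intro t
    have h := eval_add_smul_expansion w v 0 t hq.hom
    simp [Finset.sum_range_succ, Nat.factorial] at h
    rw [h]; simp [hA, hB, hD]; ring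
  have hcomplex : Polynomial.C 2 * lineRestrict q (fun j => w j) (fun j => v j)
      = Polynomial.C (D : ℂ) + Polynomial.C (2 * B : ℂ) * Polynomial.X
        + Polynomial.C (A : ℂ) * Polynomial.X ^ 2 := by
    refine Polynomial.eq_of_infinite_eval_eq _ _ ?_
    refine Set.Infinite.mono (s := Set.range ((↑) : ℝ → ℂ)) ?_
      (Set.infinite_range_of_injective Complex.ofReal_injective)
    rintro _ ⟨t, rfl⟩
    have h := congrArg ((↑) : ℝ → ℂ) (hreal t)
    have h2 := aeval_ofReal q (w + t • v)
    simp only [Set.mem_ofPred_eq, Polynomial.eval_mul, Polynomial.eval_C, eval_lineRestrict,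
      Polynomial.eval_add, Polynomial.eval_X, Polynomial.eval_pow]
    push_cast at h
    rw [← h, ← h2]
    congr 3
    funext j
    simp; ring
  by_contra! hlt
  set s := Real.sqrt (A * D - B ^ 2) with hs
  have hspos : 0 < s := Real.sqrt_pos.2 (by linarith)
  have hs2 : s ^ 2 = A * D - B ^ 2 := Real.sq_sqrt (by linarith)
  set x : ℝ := -B / A with hx
  set y : ℝ := s / A with hy
  have hypos : 0 < y := by positivity
  set τ : ℂ := ⟨x, y⟩ with hτ
  have hroot : MvPolynomial.aeval (fun j => (w j : ℂ) + v j * τ) q = 0 := by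
    have h := congrArg (Polynomial.eval τ) hcomplex
    simp only [Polynomial.eval_mul, Polynomial.eval_C, eval_lineRestrict,
      Polynomial.eval_add, Polynomial.eval_X, Polynomial.eval_pow] at h
    have h0 : (D : ℂ) + 2 * B * τ + A * τ ^ 2 = 0 := by
      apply Complex.ext
      · simp [hτ, pow_two]
        rw [hx, hy]
        field_simp
        nlinarith [hs2]
      · simp [hτ, pow_two]
        rw [hx, hy]
        field_simp
        ring
    rw [h0] at h
    simpa using h
  set c : ℂ := ⟨1, (x - 1) / y⟩ with hc
  have hcτ : (c * τ).re = 1 := by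
    simp [hc, hτ]
    field_simp
    ring
  refine hq.ne_zero (fun j => c * (w j + v j * τ)) (fun i => ?_) ?_
  · have : (∑ j, (a i j : ℂ) * (c * (w j + v j * τ))).re
        = (∑ j, a i j * w j) * c.re + (∑ j, a i j * v j) * (c * τ).re := by
      rw [Complex.re_sum, Finset.sum_mul, Finset.sum_mul, ← Finset.sum_add_distrib]
      refine Finset.sum_congr rfl fun j _ => ?_
      simp
      ring
    rw [this, hcτ]
    have := hv.2 i
    have := hw.2 i
    simp [hc]; positivity
  · rw [aeval_smul_of_isHomogeneous hq.hom, hroot, mul_zero]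

end Stability

theorem mul_pow_le_of_log_concave (u : ℕ → ℝ) {k c : ℕ} (hck : c < k)
    (hu : ∀ i ≤ k, 0 < u i) (hlc : ∀ i, i + 2 ≤ k → u (i + 2) * u i ≤ u (i + 1) ^ 2)
    {i : ℕ} (hi : i ≤ k) : u i * (u (c + 1) / u c) ^ c ≤ u c * (u (c + 1) / u c) ^ i := by
  have hc0 := hu c hck.le
  have hc1 := hu (c + 1) hck
  set ρ := u (c + 1) / u c with hρ
  have hρ0 : 0 < ρ := div_pos hc1 hc0
  have hstep : ∀ i, i + 2 ≤ k → u (i + 2) / u (i + 1) ≤ u (i + 1) / u i := by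
    intro i hi
    rw [div_le_div_iff₀ (hu _ (by omega)) (hu _ (by omega))]
    nlinarith [hlc i hi]
  have hup : ∀ n, c + n + 1 ≤ k → u (c + n + 1) / u (c + n) ≤ ρ := by
    intro n
    induction n with
    | zero => intro _; exact le_rfl
    | succ n ih => intro h; exact (hstep (c + n) (by omega)).trans (ih (by omega))
  have hdown : ∀ n, ∀ i, i + n = c → ρ ≤ u (i + 1) / u i := by
    intro n
    induction n with
    | zero => rintro i rfl; exact le_rfl
    | succ n ih => intro i h; exact (ih (i + 1) (by omega)).trans (hstep i (by omega))
  rcases le_total c i with h | h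
  · obtain ⟨n, rfl⟩ := Nat.exists_eq_add_of_le h
    clear h
    induction n with
    | zero => exact le_rfl
    | succ n ih =>
      have h1 := ih (by omega)
      have h2 := (div_le_iff₀ (hu (c + n) (by omega))).1 (hup n (by omega))
      calc u (c + (n + 1)) * ρ ^ c ≤ ρ * u (c + n) * ρ ^ c := by gcongr; exact h2
        _ = ρ * (u (c + n) * ρ ^ c) := by ring
        _ ≤ ρ * (u c * ρ ^ (c + n)) := by gcongr
        _ = u c * ρ ^ (c + (n + 1)) := by ring
  · obtain ⟨n, hn⟩ := Nat.exists_eq_add_of_le h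
    clear h
    induction n generalizing i with
    | zero => obtain rfl : i = c := by omega
              exact le_rfl
    | succ n ih =>
      have h1 := ih (i := i + 1) (by omega) (by omega)
      have h2 := (le_div_iff₀ (hu i (by omega))).1 (hdown (n + 1) i (by omega))
      have h3 : ρ * (u i * ρ ^ c) ≤ ρ * (u c * ρ ^ i) := by
        calc ρ * (u i * ρ ^ c) = (ρ * u i) * ρ ^ c := by ring
          _ ≤ u (i + 1) * ρ ^ c := by gcongr
          _ ≤ u c * ρ ^ (i + 1) := h1
          _ = ρ * (u c * ρ ^ i) := by ring
      exact le_of_mul_le_mul_left h3 hρ0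

theorem le_coeff_of_log_concave (u : ℕ → ℝ) {k c : ℕ} (hc : 0 < c) (hck : c < k)
    (hu : ∀ i ≤ k, 0 < u i) (hlc : ∀ i, i + 2 ≤ k → u (i + 2) * u i ≤ u (i + 1) ^ 2) {A : ℝ}
    (hA : ∀ t : ℝ, 0 < t → A * t ^ c ≤ ∑ i ∈ Finset.range (k + 1), (k.choose i : ℝ) * t ^ i * u i) :
    A * (c : ℝ) ^ c * ((k - c : ℕ) : ℝ) ^ (k - c) ≤ u c * (k : ℝ) ^ k := by
  have hc0 := hu c hck.le
  have hc1 := hu (c + 1) hck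
  set ρ := u (c + 1) / u c with hρ
  have hρ0 : 0 < ρ := div_pos hc1 hc0
  obtain ⟨l, rfl⟩ := Nat.exists_eq_add_of_lt hck
  have hsub : c + l + 1 - c = l + 1 := by omega
  rw [hsub]
  set d : ℝ := ((l + 1 : ℕ) : ℝ) with hd
  have hd0 : 0 < d := by positivity
  have hcR : (0 : ℝ) < c := by exact_mod_cast hc
  set t : ℝ := c / (d * ρ) with ht
  have ht0 : 0 < t := by positivity
  have htρ : t * ρ = c / d := by rw [ht]; field_simp
  have h1 : A * t ^ c * ρ ^ c ≤ u c * (c / d + 1) ^ (c + l + 1) := by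
    calc A * t ^ c * ρ ^ c
        ≤ (∑ i ∈ Finset.range (c + l + 1 + 1), ((c + l + 1).choose i : ℝ) * t ^ i * u i) * ρ ^ c := by
          gcongr; exact hA t ht0
      _ ≤ ∑ i ∈ Finset.range (c + l + 1 + 1),
            u c * ((c / d) ^ i * 1 ^ (c + l + 1 - i) * ((c + l + 1).choose i : ℝ)) := by
          rw [Finset.sum_mul]
          refine Finset.sum_le_sum fun i hi => ?_
          have hi' : i ≤ c + l + 1 := by simp at hi; omega
          have := mul_pow_le_of_log_concave u hck hu hlc hi'
          rw [← hρ] at this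
          calc ((c + l + 1).choose i : ℝ) * t ^ i * u i * ρ ^ c
              = ((c + l + 1).choose i : ℝ) * t ^ i * (u i * ρ ^ c) := by ring
            _ ≤ ((c + l + 1).choose i : ℝ) * t ^ i * (u c * ρ ^ i) := by gcongr
            _ = u c * ((t * ρ) ^ i * 1 ^ (c + l + 1 - i) * ((c + l + 1).choose i : ℝ)) := by
              rw [mul_pow]; ring
            _ = _ := by rw [htρ]
      _ = u c * (c / d + 1) ^ (c + l + 1) := by rw [← Finset.mul_sum, ← add_pow]
  have h2 : (c : ℝ) / d + 1 = ((c + l + 1 : ℕ) : ℝ) / d := by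
    rw [hd]; push_cast; field_simp; ring
  rw [h2, mul_assoc, ← mul_pow, htρ, div_pow, div_pow] at h1
  have h3 := mul_le_mul_of_nonneg_right h1 (pow_nonneg hd0.le (c + l + 1))
  have e1 : A * ((c : ℝ) ^ c / d ^ c) * d ^ (c + l + 1) = A * (c : ℝ) ^ c * d ^ (l + 1) := by
    rw [show c + l + 1 = c + (l + 1) by ring, pow_add]; field_simp
  have e2 : u c * (((c + l + 1 : ℕ) : ℝ) ^ (c + l + 1) / d ^ (c + l + 1)) * d ^ (c + l + 1)
      = u c * ((c + l + 1 : ℕ) : ℝ) ^ (c + l + 1) := by field_simp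
  rwa [e1, e2] at h3

section Capacity

variable {ι σ : Type*} [Fintype σ]

theorem IsTubeStable.log_concave {a : ι → σ → ℝ} {k : ℕ} {q : MvPolynomial σ ℝ}
    (hq : IsTubeStable a k q) {e y : σ → ℝ} (he : IsTubeDir a e) (hy : IsTubeDir a y)
    {i : ℕ} (hi : i + 2 ≤ k) :
    MvPolynomial.eval 0 ((_root_.dirDeriv e ^ (i + 2)) ((_root_.dirDeriv y ^ (k - (i + 2))) q)) *
      MvPolynomial.eval 0 ((_root_.dirDeriv e ^ i) ((_root_.dirDeriv y ^ (k - i)) q))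
      ≤ MvPolynomial.eval 0
        ((_root_.dirDeriv e ^ (i + 1)) ((_root_.dirDeriv y ^ (k - (i + 1))) q)) ^ 2 := by
  obtain ⟨l, rfl⟩ := Nat.exists_eq_add_of_le hi
  have h1 : IsTubeStable a (2 + i) ((_root_.dirDeriv y ^ l) q) :=
    IsTubeStable.dirDeriv_pow hy l (by convert hq using 1; ring)
  have h2 := (IsTubeStable.dirDeriv_pow he i h1).quadratic_inequality he hy
  have hcomm := dirDeriv_commute y e
  have e0 : i + 2 + l - (i + 2) = l := by omega
  have e1 : i + 2 + l - (i + 1) = 1 + l := by omega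
  have e2 : i + 2 + l - i = 2 + l := by omega
  rw [e0, e1, e2]
  simp only [← Module.End.mul_apply] at h2 ⊢
  have c1 : _root_.dirDeriv y ^ 2 * (_root_.dirDeriv e ^ i * _root_.dirDeriv y ^ l)
      = _root_.dirDeriv e ^ i * _root_.dirDeriv y ^ (2 + l) := by
    rw [← mul_assoc, (hcomm.pow_pow 2 i).eq, mul_assoc, ← pow_add]
  have c2 : _root_.dirDeriv e * _root_.dirDeriv y * (_root_.dirDeriv e ^ i * _root_.dirDeriv y ^ l)
      = _root_.dirDeriv e ^ (i + 1) * _root_.dirDeriv y ^ (1 + l) := by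
    rw [mul_assoc, ← mul_assoc (_root_.dirDeriv y), (hcomm.pow_right i).eq, pow_succ', pow_add]
    simp only [mul_assoc, pow_one]
  have c3 : _root_.dirDeriv e ^ 2 * (_root_.dirDeriv e ^ i * _root_.dirDeriv y ^ l)
      = _root_.dirDeriv e ^ (i + 2) * _root_.dirDeriv y ^ l := by
    rw [← mul_assoc, ← pow_add, add_comm 2]
  rw [← mul_assoc (_root_.dirDeriv e) (_root_.dirDeriv y)] at h2
  rwa [c1, c2, c3] at h2

theorem IsTubeStable.eval_dirDeriv_pow_pos {a : ι → σ → ℝ} {k : ℕ} {q : MvPolynomial σ ℝ}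
    (hq : IsTubeStable a k q) {e y : σ → ℝ} (he : IsTubeDir a e) (hy : IsTubeDir a y)
    {i : ℕ} (hi : i ≤ k) :
    0 < MvPolynomial.eval 0 ((_root_.dirDeriv e ^ i) ((_root_.dirDeriv y ^ (k - i)) q)) := by
  have h1 : IsTubeStable a (0 + i) ((_root_.dirDeriv y ^ (k - i)) q) :=
    IsTubeStable.dirDeriv_pow hy (k - i) (by convert hq using 1; omega)
  have h2 := IsTubeStable.dirDeriv_pow he i h1
  rw [eval_eq_of_isHomogeneous_zero h2.hom 0 e]
  exact h2.eval_pos he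

theorem IsTubeStable.le_eval_dirDeriv {a : ι → σ → ℝ} {k c : ℕ} (hc : 0 < c) (hk : 0 < k)
    {q : MvPolynomial σ ℝ} (hq : IsTubeStable a (k + c) q) {e y : σ → ℝ} (he : IsTubeDir a e)
    (hy : IsTubeDir a y) {A : ℝ}
    (hA : ∀ t : ℝ, 0 < t → A * t ^ c ≤ MvPolynomial.eval (y + t • e) q) :
    (k + c).factorial * A * (c : ℝ) ^ c * (k : ℝ) ^ k
      ≤ k.factorial * MvPolynomial.eval y ((_root_.dirDeriv e ^ c) q) * ((k + c : ℕ) : ℝ) ^ (k + c) := by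
  have h := le_coeff_of_log_concave
    (fun i => MvPolynomial.eval 0 ((_root_.dirDeriv e ^ i) ((_root_.dirDeriv y ^ (k + c - i)) q)))
    (k := k + c) hc (by omega) (fun i hi => hq.eval_dirDeriv_pow_pos he hy hi)
    (fun i hi => hq.log_concave he hy hi) (A := (k + c).factorial * A) (fun t ht => by
      rw [← eval_add_smul_expansion y e 0 t hq.hom, mul_assoc]
      gcongr
      exact hA t ht)
  have e1 : k + c - c = k := by omega
  rw [e1] at h
  refine h.trans_eq ?_
  rw [← eval_dirDeriv_pow_self y 0 (IsTubeStable.dirDeriv_pow he c hq).hom,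
    ← Module.End.mul_apply, ← Module.End.mul_apply, ((dirDeriv_commute e y).pow_pow c k).eq]

variable [DecidableEq σ]

theorem coeff_dirDeriv_single_pow (j : σ) (q : MvPolynomial σ ℝ) (c : ℕ) (d : σ →₀ ℕ) :
    MvPolynomial.coeff d ((dirDeriv (Pi.single j 1) ^ c) q)
      = MvPolynomial.coeff (d + Finsupp.single j c) q * ((d j + 1).ascFactorial c : ℕ) := by
  induction c generalizing d with
  | zero => simp
  | succ c ih =>
    rw [pow_succ', Module.End.mul_apply, dirDeriv_single, MvPolynomial.coeff_pderiv, ih,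
      add_assoc, ← Finsupp.single_add, add_comm 1 c, Nat.ascFactorial_succ,
      ← Nat.succ_ascFactorial]
    simp
    ring

theorem IsTubeStable.le_coeff {a : ι → σ → ℝ} (ha : ∀ i j, 0 < a i j) {c : σ → ℕ}
    (hc : ∀ j, 0 < c j) (S : Finset σ) : ∀ {A : ℝ} {q : MvPolynomial σ ℝ},
    IsTubeStable a (∑ j ∈ S, c j) q →
    (∀ y : σ → ℝ, (∀ j ∈ S, 0 < y j) → (∀ j ∉ S, y j = 0) →
      A * ∏ j ∈ S, y j ^ c j ≤ MvPolynomial.eval y q) →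
    A * (∑ j ∈ S, c j).factorial * ∏ j ∈ S, (c j : ℝ) ^ c j
      ≤ ((∑ j ∈ S, c j : ℕ) : ℝ) ^ (∑ j ∈ S, c j) * (∏ j ∈ S, ((c j).factorial : ℝ)) *
        MvPolynomial.coeff (∑ j ∈ S, Finsupp.single j (c j)) q := by
  induction S using Finset.induction_on with
  | empty =>
    intro A q hq h
    have h0 := h 0 (by simp) (by simp)
    rw [MvPolynomial.eval_zero, MvPolynomial.constantCoeff_eq] at h0
    simpa using h0
  | insert j S hj ih =>
    intro A q hq h
    rw [Finset.sum_insert hj, add_comm] at hq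
    have he : IsTubeDir a (Pi.single j 1 : σ → ℝ) := by
      refine ⟨fun l => ?_, fun i => ?_⟩
      · by_cases hl : l = j
        · subst hl; simp
        · simp [hl]
      · simpa [Pi.single_apply] using ha i j
    have hq1 := IsTubeStable.dirDeriv_pow he (c j) hq
    have hcoeff := coeff_dirDeriv_single_pow j q (c j) (∑ l ∈ S, Finsupp.single l (c l))
    have hz : (∑ l ∈ S, Finsupp.single l (c l)) j = 0 := by
      rw [Finsupp.finsetSum_apply]
      exact Finset.sum_eq_zero fun l hl => by
        rw [Finsupp.single_apply, if_neg]; rintro rfl; exact hj hl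
    rw [hz, zero_add, Nat.one_ascFactorial, add_comm] at hcoeff
    simp only [Finset.sum_insert hj, Finset.prod_insert hj]
    rcases S.eq_empty_or_nonempty with rfl | hS
    · have h1 := eval_dirDeriv_pow_self (Pi.single j 1 : σ → ℝ) 0 (k := c j) (q := q)
        (by simpa using hq.hom)
      rw [MvPolynomial.eval_zero, MvPolynomial.constantCoeff_eq] at h1
      simp only [Finset.sum_empty] at hcoeff
      rw [hcoeff] at h1
      have h2 := h (Pi.single j 1) (by simp) (by
        intro l hl
        have : l ≠ j := by simpa using hl
        simp [this])
      have h3 : A ≤ MvPolynomial.coeff (Finsupp.single j (c j) + 0) q := by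
        have hf : (0 : ℝ) < (c j).factorial := by positivity
        have h4 : A ≤ MvPolynomial.eval (Pi.single j 1) q := by simpa using h2
        refine h4.trans_eq (mul_left_cancel₀ hf.ne' ?_)
        rw [← h1]; ring
      simp only [Finset.sum_empty, Finset.prod_empty, mul_one, add_zero] at h3 ⊢
      calc A * (c j).factorial * (c j : ℝ) ^ c j
          = (c j : ℝ) ^ c j * (c j).factorial * A := by ring
        _ ≤ _ := by gcongr
    · set k := ∑ l ∈ S, c l with hk
      have hk0 : 0 < k := Finset.sum_pos (fun l _ => hc l) hS
      have hK : (0 : ℝ) < ((k + c j : ℕ) : ℝ) ^ (k + c j) := by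
        have : 0 < k + c j := by omega
        positivity
      have hkk : (0 : ℝ) < (k : ℝ) ^ k := by positivity
      have h1 := ih (A := (k + c j).factorial * A * (c j : ℝ) ^ c j * (k : ℝ) ^ k /
        (k.factorial * ((k + c j : ℕ) : ℝ) ^ (k + c j))) hq1 (by
          intro y hyS hy0
          have hy : IsTubeDir a y := by
            have hnn : ∀ l, 0 ≤ y l := fun l => by
              by_cases hl : l ∈ S
              · exact (hyS l hl).le
              · exact (hy0 l hl).ge
            refine ⟨hnn, fun i => ?_⟩
            obtain ⟨l, hl⟩ := hS
            exact Finset.sum_pos' (fun l _ => mul_nonneg (ha i l).le (hnn l))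
              ⟨l, Finset.mem_univ l, mul_pos (ha i l) (hyS l hl)⟩
          have h2 := hq.le_eval_dirDeriv (hc j) hk0 he hy (A := A * ∏ l ∈ S, y l ^ c l) (by
            intro t ht
            have h3 := h (y + t • Pi.single j 1) (by
              intro l hl
              by_cases hlj : l = j
              · subst hlj; simpa [hy0 l hj] using ht
              · have : l ∈ S := by simpa [hlj] using hl
                simpa [hlj] using hyS l this) (by
              intro l hl
              simp only [Finset.mem_insert, not_or] at hl
              simp [hl.1, hy0 l hl.2])
            refine le_trans (le_of_eq ?_) h3
            rw [Finset.prod_insert hj]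
            have : ∏ l ∈ S, (y + t • (Pi.single j 1 : σ → ℝ)) l ^ c l = ∏ l ∈ S, y l ^ c l := by
              refine Finset.prod_congr rfl fun l hl => ?_
              have : l ≠ j := by rintro rfl; exact hj hl
              simp [this]
            rw [this]
            simp [hy0 j hj]
            ring)
          rw [div_mul_eq_mul_div, div_le_iff₀ (by positivity)]
          calc _ = (k + c j).factorial * (A * ∏ l ∈ S, y l ^ c l) * (c j : ℝ) ^ c j * (k : ℝ) ^ k := by
                ring
            _ ≤ _ := h2
            _ = _ := by ring)
      rw [hcoeff] at h1
      rw [add_comm (c j) k]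
      refine le_of_mul_le_mul_left ?_ hkk
      have h4 := mul_le_mul_of_nonneg_right h1 hK.le
      calc _ = (k + c j).factorial * A * (c j : ℝ) ^ c j * (k : ℝ) ^ k /
              (k.factorial * ((k + c j : ℕ) : ℝ) ^ (k + c j)) * k.factorial *
              (∏ l ∈ S, (c l : ℝ) ^ c l) * ((k + c j : ℕ) : ℝ) ^ (k + c j) := by
            field_simp
        _ ≤ _ := h4
        _ = _ := by ring

end Capacity

section Tables

variable {m n : ℕ}

/-- The contingency tables with margins `(R, C)` as a finite set. -/
def contingencyTables (R : Fin m → ℕ) (C : Fin n → ℕ) : Finset (Fin m → Fin n → ℕ) :=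
  (Fintype.piFinset fun i => Finset.piAntidiag Finset.univ (R i)).filter
    fun D => ∀ j, ∑ i, D i j = C j

theorem mem_contingencyTables {R : Fin m → ℕ} {C : Fin n → ℕ} {D : Fin m → Fin n → ℕ} :
    D ∈ contingencyTables R C ↔ (∀ i, ∑ j, D i j = R i) ∧ ∀ j, ∑ i, D i j = C j := by
  simp [contingencyTables]

theorem tableWeight_eq_sum (R : Fin m → ℕ) (C : Fin n → ℕ) (W : Fin m → Fin n → ℝ) :
    tableWeight R C W = ∑ D ∈ contingencyTables R C, ∏ i, ∏ j, W i j ^ D i j := by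
  rw [tableWeight, ← Finset.tsum_subtype]
  exact (Equiv.subtypeEquivRight fun D => mem_contingencyTables.symm).tsum_eq
    (fun D : {D // D ∈ contingencyTables R C} => ∏ i, ∏ j, W i j ^ D.1 i j)

/-- The sum over contingency tables in which every entry `d` carries the weight `a ^ d / d!`. -/
noncomputable def expTableWeight (R : Fin m → ℕ) (C : Fin n → ℕ) (a : Fin m → Fin n → ℝ) : ℝ :=
  ∑ D ∈ contingencyTables R C, ∏ i, ∏ j, a i j ^ D i j / (D i j).factorial

theorem expTableWeight_swap (R : Fin m → ℕ) (C : Fin n → ℕ) (a : Fin m → Fin n → ℝ) :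
    expTableWeight R C a = expTableWeight C R (fun j i => a i j) := by
  refine Finset.sum_nbij' (fun D j i => D i j) (fun D i j => D j i) ?_ ?_ ?_ ?_ ?_
  · intro D hD; rw [mem_contingencyTables] at *; exact hD.symm
  · intro D hD; rw [mem_contingencyTables] at *; exact hD.symm
  · intro D _; rfl
  · intro D _; rfl
  · intro D _; exact Finset.prod_comm

theorem prod_rowSum_pow {A : Type*} [CommSemiring A] (R : Fin m → ℕ) (f : Fin m → Fin n → A) :
    ∏ i, (∑ j, f i j) ^ R i
      = ∑ D ∈ Fintype.piFinset fun i => Finset.piAntidiag Finset.univ (R i),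
        ∏ i, ((Nat.multinomial Finset.univ (D i) : A) * ∏ j, f i j ^ D i j) := by
  simp only [Finset.sum_pow_eq_sum_piAntidiag]
  rw [Finset.prod_univ_sum]

theorem prod_multinomial_mul_pow {R : Fin m → ℕ} {D : Fin m → Fin n → ℕ}
    (hD : ∀ i, ∑ j, D i j = R i) (a : Fin m → Fin n → ℝ) :
    ∏ i, ((Nat.multinomial Finset.univ (D i) : ℝ) * ∏ j, a i j ^ D i j)
      = (∏ i, ((R i).factorial : ℝ)) * ∏ i, ∏ j, a i j ^ D i j / (D i j).factorial := by
  rw [← Finset.prod_mul_distrib]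
  refine Finset.prod_congr rfl fun i _ => ?_
  have h := Nat.multinomial_spec Finset.univ (D i)
  rw [hD i] at h
  rw [← h, Finset.prod_div_distrib]
  push_cast
  have : (∏ j, ((D i j).factorial : ℝ)) ≠ 0 := Finset.prod_ne_zero_iff.2 fun j _ => by positivity
  field_simp

theorem expTableWeight_mul_le (R : Fin m → ℕ) (C : Fin n → ℕ) {a : Fin m → Fin n → ℝ}
    (ha : ∀ i j, 0 ≤ a i j) {y : Fin n → ℝ} (hy : ∀ j, 0 ≤ y j) :
    (∏ i, ((R i).factorial : ℝ)) * expTableWeight R C a * ∏ j, y j ^ C j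
      ≤ ∏ i, (∑ j, a i j * y j) ^ R i := by
  rw [prod_rowSum_pow, expTableWeight, Finset.mul_sum, Finset.sum_mul]
  refine le_trans (le_of_eq ?_) (Finset.sum_le_sum_of_subset_of_nonneg
    (Finset.filter_subset (fun D => ∀ j, ∑ i, D i j = C j) _) fun D _ _ => ?_)
  · refine Finset.sum_congr rfl fun D hD => ?_
    have hD' := mem_contingencyTables.1 hD
    rw [← prod_multinomial_mul_pow hD'.1]
    have : ∏ j, y j ^ C j = ∏ i, ∏ j, y j ^ D i j := by
      rw [Finset.prod_comm]
      exact Finset.prod_congr rfl fun j _ => by rw [Finset.prod_pow_eq_pow_sum, hD'.2]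
    rw [this, ← Finset.prod_mul_distrib]
    refine Finset.prod_congr rfl fun i _ => ?_
    simp only [mul_pow, Finset.prod_mul_distrib]
    ring
  · exact Finset.prod_nonneg fun i _ => mul_nonneg (by positivity)
      (Finset.prod_nonneg fun j _ => pow_nonneg (mul_nonneg (ha i j) (hy j)) _)

/-- The product of the row forms `∑ j, a i j X j`, the `i`-th one with multiplicity `R i`. -/
noncomputable def rowProduct (R : Fin m → ℕ) (a : Fin m → Fin n → ℝ) :
    MvPolynomial (Fin n) ℝ :=
  ∏ i, (∑ j, MvPolynomial.C (a i j) * MvPolynomial.X j) ^ R i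

theorem coeff_rowProduct (R : Fin m → ℕ) (C : Fin n → ℕ) (a : Fin m → Fin n → ℝ) :
    MvPolynomial.coeff (∑ j, Finsupp.single j (C j)) (rowProduct R a)
      = (∏ i, ((R i).factorial : ℝ)) * expTableWeight R C a := by
  have hterm : ∀ D : Fin m → Fin n → ℕ,
      ∏ i, ((Nat.multinomial Finset.univ (D i) : MvPolynomial (Fin n) ℝ) *
        ∏ j, (MvPolynomial.C (a i j) * MvPolynomial.X j) ^ D i j)
      = MvPolynomial.monomial (∑ j, Finsupp.single j (∑ i, D i j))
          (∏ i, ((Nat.multinomial Finset.univ (D i) : ℝ) * ∏ j, a i j ^ D i j)) := by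
    intro D
    have hX : ∏ i, ∏ j, (MvPolynomial.X j : MvPolynomial (Fin n) ℝ) ^ D i j
        = MvPolynomial.monomial (∑ j, Finsupp.single j (∑ i, D i j)) 1 := by
      rw [Finset.prod_comm, MvPolynomial.monomial_sum_one]
      exact Finset.prod_congr rfl fun j _ => by
        rw [Finset.prod_pow_eq_pow_sum, MvPolynomial.X_pow_eq_monomial]
    rw [← mul_one (∏ i, ((Nat.multinomial Finset.univ (D i) : ℝ) * ∏ j, a i j ^ D i j)),
      ← MvPolynomial.C_mul_monomial, ← hX]
    simp only [mul_pow, Finset.prod_mul_distrib, map_mul, map_prod, map_pow, map_natCast]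
    ring
  rw [rowProduct, prod_rowSum_pow, MvPolynomial.coeff_sum, expTableWeight, Finset.mul_sum,
    contingencyTables, Finset.sum_filter]
  refine Finset.sum_congr rfl fun D hD => ?_
  rw [hterm, MvPolynomial.coeff_monomial]
  have hiff : (∑ j, Finsupp.single j (∑ i, D i j) = ∑ j, Finsupp.single j (C j))
      ↔ ∀ j, ∑ i, D i j = C j := by
    rw [Finsupp.ext_iff]
    simp [Finsupp.finsetSum_apply, Finsupp.single_apply]
  simp only [hiff]
  split_ifs with h
  · exact prod_multinomial_mul_pow (by simpa using hD) a
  · rfl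

theorem coeff_nonneg_mul {σ : Type*} {p q : MvPolynomial σ ℝ} (hp : ∀ d, 0 ≤ p.coeff d)
    (hq : ∀ d, 0 ≤ q.coeff d) (d : σ →₀ ℕ) : 0 ≤ (p * q).coeff d := by
  classical
  rw [MvPolynomial.coeff_mul]
  exact Finset.sum_nonneg fun x _ => mul_nonneg (hp _) (hq _)

theorem coeff_nonneg_one {σ : Type*} (d : σ →₀ ℕ) : 0 ≤ (1 : MvPolynomial σ ℝ).coeff d := by
  classical
  rw [MvPolynomial.coeff_one]
  split_ifs <;> norm_num

theorem isTubeStable_rowProduct (R : Fin m → ℕ) {a : Fin m → Fin n → ℝ}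
    (ha : ∀ i j, 0 ≤ a i j) : IsTubeStable a (∑ i, R i) (rowProduct R a) := by
  refine ⟨?_, ?_, fun z hz => ?_⟩
  · refine MvPolynomial.IsHomogeneous.prod _ _ _ fun i _ => ?_
    have h : (∑ j, MvPolynomial.C (a i j) * MvPolynomial.X j).IsHomogeneous 1 :=
      MvPolynomial.IsHomogeneous.sum _ _ _ fun j _ => by
        simpa using (MvPolynomial.isHomogeneous_C _ (a i j)).mul (MvPolynomial.isHomogeneous_X ℝ j)
    simpa using h.pow (R i)
  · refine Finset.prod_induction _ (fun p : MvPolynomial (Fin n) ℝ => ∀ d, 0 ≤ p.coeff d)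
      (fun p q hp hq => coeff_nonneg_mul hp hq) coeff_nonneg_one fun i _ => ?_
    induction R i with
    | zero => simpa using coeff_nonneg_one
    | succ k ih =>
      rw [pow_succ]
      refine coeff_nonneg_mul ih fun d => ?_
      rw [MvPolynomial.coeff_sum]
      refine Finset.sum_nonneg fun j _ => ?_
      rw [MvPolynomial.coeff_C_mul, MvPolynomial.coeff_X]
      split_ifs <;> simp [ha i j]
  · rw [rowProduct, map_prod]
    refine Finset.prod_ne_zero_iff.2 fun i _ => ?_
    rw [map_pow]
    refine pow_ne_zero _ fun h => ?_
    have h' : ∑ j, (a i j : ℂ) * z j = 0 := by simpa using h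
    have := hz i
    rw [h'] at this
    simp at this

theorem eval_rowProduct (R : Fin m → ℕ) (a : Fin m → Fin n → ℝ) (y : Fin n → ℝ) :
    MvPolynomial.eval y (rowProduct R a) = ∏ i, (∑ j, a i j * y j) ^ R i := by
  simp [rowProduct, map_prod]

theorem pow_mul_prod_pow_le {N : ℕ} {R : Fin m → ℕ} (hR : ∀ i, 0 < R i) (hN : ∑ i, R i = N)
    {z : Fin m → ℝ} (hz : ∀ i, 0 ≤ z i) :
    (N : ℝ) ^ N * ∏ i, z i ^ R i ≤ (∏ i, (R i : ℝ) ^ R i) * (∑ i, z i) ^ N := by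
  rcases Nat.eq_zero_or_pos N with rfl | hpos
  · have h0 : ∀ i, R i = 0 := by simpa using hN
    simp [h0]
  have hNR : (0 : ℝ) < N := by exact_mod_cast hpos
  have hsum : ∑ i, (R i : ℝ) = N := by exact_mod_cast hN
  have h := Real.geom_mean_le_arith_mean Finset.univ (fun i => (R i : ℝ)) (fun i => z i / R i)
    (fun i _ => by positivity) (by rw [hsum]; exact hNR)
    (fun i _ => div_nonneg (hz i) (by positivity))
  have e1 : ∀ i, (R i : ℝ) * (z i / R i) = z i := fun i => by
    have : (R i : ℝ) ≠ 0 := by have := hR i; positivity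
    field_simp
  simp only [e1, hsum, Real.rpow_natCast] at h
  have hP : 0 ≤ ∏ i, (z i / R i) ^ R i :=
    Finset.prod_nonneg fun i _ => pow_nonneg (div_nonneg (hz i) (by positivity)) _
  have h2 := pow_le_pow_left₀ (Real.rpow_nonneg hP _) h N
  rw [Real.rpow_inv_natCast_pow hP hpos.ne', div_pow] at h2
  simp only [div_pow, Finset.prod_div_distrib] at h2
  have hRR : 0 < ∏ i, (R i : ℝ) ^ R i := Finset.prod_pos fun i _ => by have := hR i; positivity
  rw [div_le_div_iff₀ hRR (by positivity)] at h2
  linarith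

theorem omegaVec_mul_prod_factorial {l : ℕ} (B : Fin l → ℕ) :
    omegaVec B * ∏ i, ((B i).factorial : ℝ) = ∏ i, (B i : ℝ) ^ B i := by
  rw [omegaVec, ← Finset.prod_mul_distrib]
  exact Finset.prod_congr rfl fun i _ => by field_simp

theorem omegaVec_pos {l : ℕ} {B : Fin l → ℕ} (hB : ∀ i, 0 < B i) : 0 < omegaVec B :=
  Finset.prod_pos fun i _ => by have := hB i; positivity

/-- The bilinear form `∑ a i j x i y j`. -/
def bilinSum (a : Fin m → Fin n → ℝ) (x : Fin m → ℝ) (y : Fin n → ℝ) : ℝ :=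
  ∑ i, ∑ j, a i j * x i * y j

theorem expTableWeight_le_omegaVec_left {N : ℕ} {R : Fin m → ℕ} (C : Fin n → ℕ)
    (hR : ∀ i, 0 < R i) (hN : ∑ i, R i = N) {a : Fin m → Fin n → ℝ} (ha : ∀ i j, 0 ≤ a i j)
    {x : Fin m → ℝ} {y : Fin n → ℝ} (hx : ∀ i, 0 ≤ x i) (hy : ∀ j, 0 ≤ y j) :
    (N : ℝ) ^ N * expTableWeight R C a * ((∏ i, x i ^ R i) * ∏ j, y j ^ C j)
      ≤ omegaVec R * bilinSum a x y ^ N := by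
  have h1 := expTableWeight_mul_le R C ha hy
  have h2 := pow_mul_prod_pow_le hR hN (z := fun i => x i * ∑ j, a i j * y j)
    (fun i => mul_nonneg (hx i) (Finset.sum_nonneg fun j _ => mul_nonneg (ha i j) (hy j)))
  have hb : ∑ i, x i * ∑ j, a i j * y j = bilinSum a x y := by
    simp only [bilinSum, Finset.mul_sum]
    exact Finset.sum_congr rfl fun i _ => Finset.sum_congr rfl fun j _ => by ring
  rw [hb, ← omegaVec_mul_prod_factorial] at h2
  simp only [mul_pow, Finset.prod_mul_distrib] at h2
  have hF : (0 : ℝ) < ∏ i, ((R i).factorial : ℝ) := Finset.prod_pos fun i _ => by positivity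
  have hX : 0 ≤ ∏ i, x i ^ R i := Finset.prod_nonneg fun i _ => pow_nonneg (hx i) _
  refine le_of_mul_le_mul_left ?_ hF
  calc _ = (N : ℝ) ^ N * ((∏ i, x i ^ R i) * ((∏ i, ((R i).factorial : ℝ)) *
        expTableWeight R C a * ∏ j, y j ^ C j)) := by ring
    _ ≤ (N : ℝ) ^ N * ((∏ i, x i ^ R i) * ∏ i, (∑ j, a i j * y j) ^ R i) := by gcongr
    _ ≤ _ := h2
    _ = _ := by ring

theorem expTableWeight_le_min_omegaVec {N : ℕ} {R : Fin m → ℕ} {C : Fin n → ℕ}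
    (hR : ∀ i, 0 < R i) (hC : ∀ j, 0 < C j) (hRN : ∑ i, R i = N) (hCN : ∑ j, C j = N)
    {a : Fin m → Fin n → ℝ} (ha : ∀ i j, 0 ≤ a i j)
    {x : Fin m → ℝ} {y : Fin n → ℝ} (hx : ∀ i, 0 ≤ x i) (hy : ∀ j, 0 ≤ y j) :
    (N : ℝ) ^ N * expTableWeight R C a * ((∏ i, x i ^ R i) * ∏ j, y j ^ C j)
      ≤ min (omegaVec R) (omegaVec C) * bilinSum a x y ^ N := by
  rcases min_choice (omegaVec R) (omegaVec C) with h | h <;> rw [h]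
  · exact expTableWeight_le_omegaVec_left C hR hRN ha hx hy
  · have h1 := expTableWeight_le_omegaVec_left R hC hCN (a := fun j i => a i j)
      (fun j i => ha i j) hy hx
    have hb : bilinSum (fun j i => a i j) y x = bilinSum a x y := by
      rw [bilinSum, Finset.sum_comm]
      exact Finset.sum_congr rfl fun i _ => Finset.sum_congr rfl fun j _ => by ring
    rwa [hb, ← expTableWeight_swap, mul_comm (∏ j, y j ^ C j)] at h1

theorem le_expTableWeight_of_capacity {N : ℕ} {R : Fin m → ℕ} {C : Fin n → ℕ}
    (hR : ∀ i, 0 < R i) (hC : ∀ j, 0 < C j) (hRN : ∑ i, R i = N) (hCN : ∑ j, C j = N)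
    {a : Fin m → Fin n → ℝ} (ha : ∀ i j, 0 < a i j) {A : ℝ}
    (hA : ∀ x y, (∀ i, 0 < x i) → (∀ j, 0 < y j) →
      A * ((∏ i, x i ^ R i) * ∏ j, y j ^ C j) ≤ bilinSum a x y ^ N) :
    A * N.factorial * (omegaVec R * omegaVec C) ≤ (N : ℝ) ^ N * (N : ℝ) ^ N * expTableWeight R C a := by
  have hst := isTubeStable_rowProduct R fun i j => (ha i j).le
  rw [hRN, ← hCN] at hst
  have hNN : (0 : ℝ) < (N : ℝ) ^ N := by
    rcases Nat.eq_zero_or_pos N with h | h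
    · simp [h]
    · positivity
  have hRR : 0 < ∏ i, (R i : ℝ) ^ R i := Finset.prod_pos fun i _ => by have := hR i; positivity
  have h := hst.le_coeff ha hC Finset.univ (A := A * (∏ i, (R i : ℝ) ^ R i) / (N : ℝ) ^ N) (by
    intro y hy _
    have hy' : ∀ j, 0 < y j := fun j => hy j (Finset.mem_univ j)
    rw [eval_rowProduct]
    rcases isEmpty_or_nonempty (Fin n) with hn | hn
    · have hN0 : N = 0 := by rw [← hCN]; simp
      subst hN0
      have hR0 : ∀ i, R i = 0 := by simpa using hRN
      simpa [hR0] using hA 1 1 (by simp) (by simp)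
    have hs : ∀ i, 0 < ∑ j, a i j * y j := fun i =>
      Finset.sum_pos (fun j _ => mul_pos (ha i j) (hy' j)) Finset.univ_nonempty
    have h1 := hA (fun i => R i / ∑ j, a i j * y j) y
      (fun i => div_pos (by exact_mod_cast hR i) (hs i)) hy'
    have hb : bilinSum a (fun i => R i / ∑ j, a i j * y j) y = N := by
      have : ∀ i, ∑ j, a i j * (R i / ∑ j, a i j * y j) * y j = R i := fun i => by
        have e : ∀ j, a i j * (R i / ∑ j, a i j * y j) * y j
            = (R i / ∑ j, a i j * y j) * (a i j * y j) := fun j => by ring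
        rw [Finset.sum_congr rfl fun j _ => e j, ← Finset.mul_sum]
        exact div_mul_cancel₀ _ (hs i).ne'
      simp only [bilinSum, this]
      exact_mod_cast hRN
    rw [hb] at h1
    simp only [div_pow, Finset.prod_div_distrib] at h1
    have hP : 0 < ∏ i, (∑ j, a i j * y j) ^ R i :=
      Finset.prod_pos fun i _ => pow_pos (hs i) _
    rw [div_mul_eq_mul_div, div_le_iff₀ hNN, ← sub_nonneg]
    rw [div_mul_eq_mul_div, mul_div_assoc', div_le_iff₀ hP] at h1
    linarith)
  rw [coeff_rowProduct, hCN, ← omegaVec_mul_prod_factorial, ← omegaVec_mul_prod_factorial] at h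
  have hF : (0 : ℝ) < ∏ i, ((R i).factorial : ℝ) := Finset.prod_pos fun i _ => by positivity
  have hG : (0 : ℝ) < ∏ i, ((C i).factorial : ℝ) := Finset.prod_pos fun i _ => by positivity
  refine le_of_mul_le_mul_left ?_ (mul_pos hF hG)
  rw [div_mul_eq_mul_div, div_mul_eq_mul_div, div_le_iff₀ hNN] at h
  linarith

end Tables

section PrekopaLeindler

open Filter Topology

theorem bounds_of_antideriv {F f : ℝ → ℝ} {I : ℝ} (hF : ∀ t, 0 < t → HasDerivAt F (f t) t)
    (hf : ∀ t, 0 < t → 0 ≤ f t) (h0 : Tendsto F (𝓝[>] 0) (𝓝 0)) (hI : Tendsto F atTop (𝓝 I))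
    {t : ℝ} (ht : 0 < t) : 0 ≤ F t ∧ F t ≤ I := by
  have hmono : MonotoneOn F (Set.Ioi 0) := by
    refine monotoneOn_of_deriv_nonneg (convex_Ioi 0)
      (fun s hs => (hF s hs).continuousAt.continuousWithinAt) ?_ ?_
    · rw [interior_Ioi]
      exact fun s hs => (hF s hs).differentiableAt.differentiableWithinAt
    · rw [interior_Ioi]
      exact fun s hs => by rw [(hF s hs).deriv]; exact hf s hs
  constructor
  · refine le_of_tendsto h0 ?_
    filter_upwards [Ioo_mem_nhdsGT ht] with s hs
    exact hmono hs.1 ht hs.2.le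
  · refine ge_of_tendsto hI ?_
    filter_upwards [eventually_ge_atTop t] with s hs
    exact hmono ht (ht.trans_le hs) hs

theorem exists_quantile {F f : ℝ → ℝ} {I : ℝ} (hF : ∀ t, 0 < t → HasDerivAt F (f t) t)
    (hf : ∀ t, 0 < t → 0 < f t) (h0 : Tendsto F (𝓝[>] 0) (𝓝 0)) (hI : Tendsto F atTop (𝓝 I)) :
    0 < I ∧ ∃ T : ℝ → ℝ, ∀ u ∈ Set.Ioo (0 : ℝ) 1,
      0 < T u ∧ HasDerivAt T (I / f (T u)) u := by
  have hcont : ContinuousOn F (Set.Ioi 0) :=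
    fun s hs => (hF s hs).continuousAt.continuousWithinAt
  have hmono : StrictMonoOn F (Set.Ioi 0) := by
    refine strictMonoOn_of_deriv_pos (convex_Ioi 0) hcont ?_
    rw [interior_Ioi]
    exact fun s hs => by rw [(hF s hs).deriv]; exact hf s hs
  have hb := fun t ht => bounds_of_antideriv hF (fun s hs => (hf s hs).le) h0 hI (t := t) ht
  have hlow : ∀ t, 0 < t → 0 < F t := fun t ht =>
    (hb (t / 2) (by positivity)).1.trans_lt (hmono (half_pos ht) ht (half_lt_self ht))
  have hupp : ∀ t, 0 < t → F t < I := fun t ht =>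
    (hmono ht (show (0 : ℝ) < t + 1 by positivity) (lt_add_one t)).trans_le
      (hb (t + 1) (by positivity)).2
  have hIpos : 0 < I := (hlow 1 one_pos).trans (hupp 1 one_pos)
  refine ⟨hIpos, ?_⟩
  have hex : ∀ u : ℝ, ∃ t, u ∈ Set.Ioo (0 : ℝ) 1 → 0 < t ∧ F t = I * u := by
    intro u
    by_cases hu : u ∈ Set.Ioo (0 : ℝ) 1
    swap
    · exact ⟨0, fun h => absurd h hu⟩
    have hv0 : 0 < I * u := mul_pos hIpos hu.1
    have hv1 : I * u < I := by nlinarith [hu.2]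
    obtain ⟨s, hs, hs0⟩ := ((h0.eventually (gt_mem_nhds hv0)).and self_mem_nhdsWithin).exists
    obtain ⟨t, ht, ht0⟩ := ((hI.eventually (lt_mem_nhds hv1)).and (eventually_gt_atTop 0)).exists
    obtain ⟨r, hr, hr'⟩ := isPreconnected_Ioi.intermediate_value hs0 ht0 hcont ⟨hs.le, ht.le⟩
    exact ⟨r, fun _ => ⟨hr, hr'⟩⟩
  choose T hT using hex
  have hTmono : MonotoneOn T (Set.Ioo 0 1) := by
    intro u hu v hv huv
    rw [← hmono.le_iff_le (hT u hu).1 (hT v hv).1, (hT u hu).2, (hT v hv).2]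
    gcongr
  have himage : ∀ t, 0 < t → t ∈ T '' Set.Ioo 0 1 := by
    intro t ht
    have hu : F t / I ∈ Set.Ioo (0 : ℝ) 1 :=
      ⟨div_pos (hlow t ht) hIpos, (div_lt_one hIpos).2 (hupp t ht)⟩
    refine ⟨F t / I, hu, hmono.injOn (hT _ hu).1 ht ?_⟩
    rw [(hT _ hu).2]
    field_simp
  refine ⟨T, fun u hu => ⟨(hT u hu).1, ?_⟩⟩
  have hnhds : Set.Ioo (0 : ℝ) 1 ∈ 𝓝 u := Ioo_mem_nhds hu.1 hu.2
  have hTc : ContinuousAt T u := continuousAt_of_monotoneOn_of_image_mem_nhds hTmono hnhds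
    (Filter.mem_of_superset (Ioi_mem_nhds (hT u hu).1) himage)
  have hpos := hf _ (hT u hu).1
  have := HasDerivAt.of_local_left_inverse hTc ((hF _ (hT u hu).1).div_const I)
    (div_pos hpos hIpos).ne' (by
      filter_upwards [hnhds] with v hv
      rw [(hT v hv).2]
      field_simp)
  rwa [inv_div] at this

variable {κ : Type*} [Fintype κ]

theorem exists_pos_weight {α : κ → ℝ} (hα1 : ∑ k, α k = 1) :
    ∃ k, 0 < α k := by
  by_contra! h
  have := Finset.sum_nonpos fun k (_ : k ∈ Finset.univ) => h k
  linarith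

theorem convexComb_pos {α : κ → ℝ} (hα : ∀ k, 0 ≤ α k) (hα1 : ∑ k, α k = 1) {t : κ → ℝ}
    (ht : ∀ k, 0 < t k) : 0 < ∑ k, α k * t k := by
  obtain ⟨k, hk⟩ := exists_pos_weight hα1
  exact Finset.sum_pos' (fun k _ => mul_nonneg (hα k) (ht k).le)
    ⟨k, Finset.mem_univ k, mul_pos hk (ht k)⟩

/-- The one-dimensional Prékopa–Leindler inequality on the half-line, in terms of
antiderivatives. -/
theorem prekopa_leindler_antideriv {α : κ → ℝ} (hα : ∀ k, 0 ≤ α k) (hα1 : ∑ k, α k = 1)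
    {H h : ℝ → ℝ} {J : ℝ} {F f : κ → ℝ → ℝ} {I : κ → ℝ}
    (hH : ∀ t, 0 < t → HasDerivAt H (h t) t) (hh : ∀ t, 0 < t → 0 ≤ h t)
    (hH0 : Tendsto H (𝓝[>] 0) (𝓝 0)) (hHJ : Tendsto H atTop (𝓝 J))
    (hF : ∀ k t, 0 < t → HasDerivAt (F k) (f k t) t) (hf : ∀ k t, 0 < t → 0 < f k t)
    (hF0 : ∀ k, Tendsto (F k) (𝓝[>] 0) (𝓝 0)) (hFI : ∀ k, Tendsto (F k) atTop (𝓝 (I k)))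
    (hle : ∀ t : κ → ℝ, (∀ k, 0 < t k) → ∏ k, f k (t k) ^ α k ≤ h (∑ k, α k * t k)) :
    ∏ k, I k ^ α k ≤ J := by
  have hI : ∀ k, 0 < I k := fun k => (exists_quantile (hF k) (hf k) (hF0 k) (hFI k)).1
  choose T hT using fun k => (exists_quantile (hF k) (hf k) (hF0 k) (hFI k)).2
  set c := ∏ k, I k ^ α k with hc
  set S : ℝ → ℝ := fun u => ∑ k, α k * T k u with hS
  have hSpos : ∀ u ∈ Set.Ioo (0 : ℝ) 1, 0 < S u :=
    fun u hu => convexComb_pos hα hα1 fun k => (hT k u hu).1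
  have hder : ∀ u ∈ Set.Ioo (0 : ℝ) 1, HasDerivAt (fun u => H (S u) - c * u)
      (h (S u) * (∑ k, α k * (I k / f k (T k u))) - c * 1) u := by
    intro u hu
    have hS' : HasDerivAt S (∑ k, α k * (I k / f k (T k u))) u :=
      HasDerivAt.fun_sum fun k _ => (hT k u hu).2.const_mul (α k)
    exact ((hH _ (hSpos u hu)).comp u hS').sub ((hasDerivAt_id u).const_mul c)
  have hnonneg : ∀ u ∈ Set.Ioo (0 : ℝ) 1,
      0 ≤ h (S u) * (∑ k, α k * (I k / f k (T k u))) - c * 1 := by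
    intro u hu
    have hfp : ∀ k, 0 < f k (T k u) := fun k => hf k _ (hT k u hu).1
    have h1 := Real.geom_mean_le_arith_mean_weighted Finset.univ α (fun k => I k / f k (T k u))
      (fun k _ => hα k) hα1 (fun k _ => (div_pos (hI k) (hfp k)).le)
    have h2 := hle (fun k => T k u) fun k => (hT k u hu).1
    have hP : 0 < ∏ k, f k (T k u) ^ α k := Finset.prod_pos fun k _ => Real.rpow_pos_of_pos (hfp k) _
    have h3 : ∏ k, (I k / f k (T k u)) ^ α k = c / ∏ k, f k (T k u) ^ α k := by
      rw [hc, ← Finset.prod_div_distrib]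
      exact Finset.prod_congr rfl fun k _ => Real.div_rpow (hI k).le (hfp k).le _
    rw [h3] at h1
    have h4 : c / (∏ k, f k (T k u) ^ α k) * ∏ k, f k (T k u) ^ α k = c :=
      div_mul_cancel₀ _ hP.ne'
    have hc0 : 0 ≤ c / ∏ k, f k (T k u) ^ α k :=
      div_nonneg (Finset.prod_nonneg fun k _ => Real.rpow_nonneg (hI k).le _) hP.le
    have h5 := mul_le_mul h1 h2 hP.le (hc0.trans h1)
    rw [h4] at h5
    linarith
  have hmono : MonotoneOn (fun u => H (S u) - c * u) (Set.Ioo 0 1) := by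
    refine monotoneOn_of_deriv_nonneg (convex_Ioo 0 1)
      (fun u hu => (hder u hu).continuousAt.continuousWithinAt) ?_ ?_
    · rw [interior_Ioo]
      exact fun u hu => (hder u hu).differentiableAt.differentiableWithinAt
    · rw [interior_Ioo]
      exact fun u hu => by rw [(hder u hu).deriv]; exact hnonneg u hu
  have hbound : ∀ᶠ ε : ℝ in 𝓝[>] 0, c * (1 - 2 * ε) ≤ J := by
    filter_upwards [Ioo_mem_nhdsGT (show (0 : ℝ) < 1 / 2 by norm_num)] with ε hε
    have hu : ε ∈ Set.Ioo (0 : ℝ) 1 := ⟨hε.1, by linarith [hε.2]⟩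
    have hv : 1 - ε ∈ Set.Ioo (0 : ℝ) 1 := ⟨by linarith [hε.2], by linarith [hε.1]⟩
    have h1 := hmono hu hv (by linarith [hε.2])
    have h2 := (bounds_of_antideriv hH hh hH0 hHJ (hSpos _ hu)).1
    have h3 := (bounds_of_antideriv hH hh hH0 hHJ (hSpos _ hv)).2
    simp only at h1
    linarith
  refine le_of_tendsto ?_ hbound
  have : Tendsto (fun ε : ℝ => c * (1 - 2 * ε)) (𝓝 0) (𝓝 (c * (1 - 2 * 0))) :=
    Continuous.tendsto (by fun_prop) 0
  simpa using this.mono_left nhdsWithin_le_nhds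

theorem exists_antideriv_pow_mul_exp (d : ℕ) : ∃ F : ℝ → ℝ,
    (∀ t, HasDerivAt F (t ^ d * Real.exp (-t)) t) ∧ Tendsto F (𝓝[>] 0) (𝓝 0) ∧
      Tendsto F atTop (𝓝 d.factorial) := by
  have hexp : ∀ t : ℝ, HasDerivAt (fun t => Real.exp (-t)) (-Real.exp (-t)) t := fun t => by
    simpa using (hasDerivAt_neg t).exp
  induction d with
  | zero =>
    refine ⟨fun t => 1 - Real.exp (-t), fun t => by simpa using (hexp t).const_sub 1, ?_, ?_⟩
    · have : Tendsto (fun t : ℝ => 1 - Real.exp (-t)) (𝓝 0) (𝓝 (1 - Real.exp (-0))) :=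
        Continuous.tendsto (by fun_prop) 0
      simpa using this.mono_left nhdsWithin_le_nhds
    · simpa using (Real.tendsto_exp_neg_atTop_nhds_zero).const_sub 1
  | succ d ih =>
    obtain ⟨F, hF, hF0, hF1⟩ := ih
    refine ⟨fun t => (d + 1) * F t - t ^ (d + 1) * Real.exp (-t), fun t => ?_, ?_, ?_⟩
    · refine (((hF t).const_mul ((d : ℝ) + 1)).sub
        ((hasDerivAt_pow (d + 1) t).mul (hexp t))).congr_deriv ?_
      push_cast [Nat.add_sub_cancel]
      ring
    · have h1 : Tendsto (fun t : ℝ => t ^ (d + 1) * Real.exp (-t)) (𝓝 0)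
          (𝓝 (0 ^ (d + 1) * Real.exp (-0))) := Continuous.tendsto (by fun_prop) 0
      simpa using (hF0.const_mul ((d : ℝ) + 1)).sub (h1.mono_left nhdsWithin_le_nhds)
    · have h1 := Real.tendsto_pow_mul_exp_neg_atTop_nhds_zero (d + 1)
      simpa [Nat.factorial_succ] using (hF1.const_mul ((d : ℝ) + 1)).sub h1

variable {τ : Type*}

theorem exists_antideriv_sum_pow_mul_exp (s : Finset τ) (a : τ → ℝ) (e : τ → ℕ) : ∃ F : ℝ → ℝ,
    (∀ t, HasDerivAt F ((∑ x ∈ s, a x * t ^ e x) * Real.exp (-t)) t) ∧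
      Tendsto F (𝓝[>] 0) (𝓝 0) ∧ Tendsto F atTop (𝓝 (∑ x ∈ s, a x * (e x).factorial)) := by
  choose F hF hF0 hF1 using exists_antideriv_pow_mul_exp
  refine ⟨fun t => ∑ x ∈ s, a x * F (e x) t, fun t => ?_, ?_, ?_⟩
  · rw [Finset.sum_mul]
    refine HasDerivAt.fun_sum fun x _ => ?_
    rw [mul_assoc]
    exact (hF (e x) t).const_mul (a x)
  · have := tendsto_finsetSum s fun x _ => (hF0 (e x)).const_mul (a x)
    simpa using this
  · exact tendsto_finsetSum s fun x _ => (hF1 (e x)).const_mul (a x)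

/-- A Prékopa–Leindler inequality for the functional `t ^ d ↦ d!`, that is, for the
expectation with respect to an exponential random variable. -/
theorem prekopa_leindler_factorial {α : κ → ℝ} (hα : ∀ k, 0 ≤ α k) (hα1 : ∑ k, α k = 1)
    (e : τ → ℕ) {s : Finset τ} {a : τ → ℝ} (ha : ∀ x ∈ s, 0 ≤ a x) {sk : κ → Finset τ}
    {ak : κ → τ → ℝ} (hsk : ∀ k, (sk k).Nonempty) (hak : ∀ k, ∀ x ∈ sk k, 0 < ak k x)
    (hle : ∀ t : κ → ℝ, (∀ k, 0 < t k) →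
      ∏ k, (∑ x ∈ sk k, ak k x * t k ^ e x) ^ α k ≤ ∑ x ∈ s, a x * (∑ k, α k * t k) ^ e x) :
    ∏ k, (∑ x ∈ sk k, ak k x * (e x).factorial) ^ α k ≤ ∑ x ∈ s, a x * (e x).factorial := by
  obtain ⟨H, hH, hH0, hH1⟩ := exists_antideriv_sum_pow_mul_exp s a e
  choose F hF hF0 hF1 using fun k => exists_antideriv_sum_pow_mul_exp (sk k) (ak k) e
  have hpos : ∀ k t, 0 < t → 0 < ∑ x ∈ sk k, ak k x * t ^ e x := fun k t ht =>
    Finset.sum_pos (fun x hx => mul_pos (hak k x hx) (pow_pos ht _)) (hsk k)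
  refine prekopa_leindler_antideriv hα hα1 (fun t _ => hH t)
    (fun t ht => mul_nonneg (Finset.sum_nonneg fun x hx => mul_nonneg (ha x hx)
      (pow_nonneg ht.le _)) (Real.exp_pos _).le) hH0 hH1 (fun k t _ => hF k t)
    (fun k t ht => mul_pos (hpos k t ht) (Real.exp_pos _)) hF0 hF1 fun t ht => ?_
  have h1 : ∏ k, ((∑ x ∈ sk k, ak k x * t k ^ e x) * Real.exp (-t k)) ^ α k
      = (∏ k, (∑ x ∈ sk k, ak k x * t k ^ e x) ^ α k) * Real.exp (-∑ k, α k * t k) := by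
    rw [← Finset.sum_neg_distrib, Real.exp_sum, ← Finset.prod_mul_distrib]
    refine Finset.prod_congr rfl fun k _ => ?_
    rw [Real.mul_rpow (hpos k _ (ht k)).le (Real.exp_pos _).le, ← Real.exp_mul]
    congr 2
    ring
  rw [h1]
  gcongr
  exact hle t ht

variable {ι : Type*} [Fintype ι] [DecidableEq ι]

/-- The monomial `∏ i, γ i ^ d i` with the variables in `S` integrated out. -/
def partialMoment (S : Finset ι) (γ : ι → ℝ) (d : ι → ℕ) : ℝ :=
  ∏ i, if i ∈ S then ((d i).factorial : ℝ) else γ i ^ d i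

theorem partialMoment_update (S : Finset ι) (γ : ι → ℝ) (d : ι → ℕ) {i : ι} (hi : i ∉ S) (t : ℝ) :
    partialMoment S (Function.update γ i t) d
      = (∏ j ∈ Finset.univ.erase i, if j ∈ S then ((d j).factorial : ℝ) else γ j ^ d j)
        * t ^ d i := by
  rw [partialMoment, ← Finset.prod_erase_mul _ _ (Finset.mem_univ i)]
  congr 1
  · refine Finset.prod_congr rfl fun j hj => ?_
    rw [Function.update_of_ne (Finset.ne_of_mem_erase hj)]
  · simp [hi]

theorem partialMoment_insert (S : Finset ι) (γ : ι → ℝ) (d : ι → ℕ) (i : ι) :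
    partialMoment (insert i S) γ d
      = (∏ j ∈ Finset.univ.erase i, if j ∈ S then ((d j).factorial : ℝ) else γ j ^ d j)
        * (d i).factorial := by
  rw [partialMoment, ← Finset.prod_erase_mul _ _ (Finset.mem_univ i)]
  congr 1
  · refine Finset.prod_congr rfl fun j hj => ?_
    simp [Finset.ne_of_mem_erase hj]
  · simp

theorem prekopa_leindler_prod_factorial {α : κ → ℝ} (hα : ∀ k, 0 ≤ α k) (hα1 : ∑ k, α k = 1)
    (e : τ → ι → ℕ) {s : Finset τ} {a : τ → ℝ} (ha : ∀ x ∈ s, 0 ≤ a x) {sk : κ → Finset τ}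
    {ak : κ → τ → ℝ} (hsk : ∀ k, (sk k).Nonempty) (hak : ∀ k, ∀ x ∈ sk k, 0 < ak k x)
    (hle : ∀ γ : κ → ι → ℝ, (∀ k i, 0 < γ k i) →
      ∏ k, (∑ x ∈ sk k, ak k x * ∏ i, γ k i ^ e x i) ^ α k
        ≤ ∑ x ∈ s, a x * ∏ i, (∑ k, α k * γ k i) ^ e x i) :
    ∏ k, (∑ x ∈ sk k, ak k x * ∏ i, ((e x i).factorial : ℝ)) ^ α k
      ≤ ∑ x ∈ s, a x * ∏ i, ((e x i).factorial : ℝ) := by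
  have key : ∀ S : Finset ι, ∀ γ : κ → ι → ℝ, (∀ k i, 0 < γ k i) →
      ∏ k, (∑ x ∈ sk k, ak k x * partialMoment S (γ k) (e x)) ^ α k
        ≤ ∑ x ∈ s, a x * partialMoment S (fun i => ∑ k, α k * γ k i) (e x) := by
    intro S
    induction S using Finset.induction_on with
    | empty => simpa [partialMoment] using hle
    | insert i S hi ih =>
      intro γ hγ
      have hrest : ∀ (γ : ι → ℝ), (∀ i, 0 < γ i) → ∀ d : ι → ℕ,
          0 < ∏ j ∈ Finset.univ.erase i, if j ∈ S then ((d j).factorial : ℝ) else γ j ^ d j := by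
        intro γ hγ d
        refine Finset.prod_pos fun j _ => ?_
        split_ifs
        · positivity
        · exact pow_pos (hγ j) _
      have hmix : ∀ i, 0 < ∑ k, α k * γ k i := fun i => convexComb_pos hα hα1 fun k => hγ k i
      simp only [partialMoment_insert, ← mul_assoc]
      refine prekopa_leindler_factorial hα hα1 (fun x => e x i)
        (fun x hx => mul_nonneg (ha x hx) (hrest _ hmix _).le) hsk
        (fun k x hx => mul_pos (hak k x hx) (hrest _ (hγ k) _)) fun t ht => ?_
      have h := ih (fun k => Function.update (γ k) i (t k)) (fun k j => by
        by_cases hj : j = i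
        · subst hj; simpa using ht k
        · simpa [hj] using hγ k j)
      have hupd : (fun j => ∑ k, α k * Function.update (γ k) i (t k) j)
          = Function.update (fun j => ∑ k, α k * γ k j) i (∑ k, α k * t k) := by
        funext j
        by_cases hj : j = i
        · subst hj; simp
        · simp [hj]
      rw [hupd] at h
      simpa only [partialMoment_update S _ _ hi, ← mul_assoc] using h
  simpa [partialMoment] using key Finset.univ (fun _ _ => 1) (by simp)

end PrekopaLeindler

section BrunnMinkowski

variable {m n : ℕ}

theorem contingencyTables_nonempty {N : ℕ} {R : Fin m → ℕ} {C : Fin n → ℕ}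
    (hR : ∀ i, 0 < R i) (hC : ∀ j, 0 < C j) (hRN : ∑ i, R i = N) (hCN : ∑ j, C j = N) :
    (contingencyTables R C).Nonempty := by
  have hle : ∀ {l : ℕ} (B : Fin l → ℕ) (x : Fin l → ℝ), (∀ i, 0 < x i) → ∑ i, B i = N →
      ∏ i, x i ^ B i ≤ (∑ i, x i) ^ N := by
    intro l B x hx hB
    rw [← hB, ← Finset.prod_pow_eq_pow_sum]
    exact Finset.prod_le_prod (fun i _ => pow_nonneg (hx i).le _) fun i _ =>
      pow_le_pow_left₀ (hx i).le
        (Finset.single_le_sum (fun i _ => (hx i).le) (Finset.mem_univ i)) _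
  have h := le_expTableWeight_of_capacity hR hC hRN hCN (a := fun _ _ => 1) (A := 1)
    (fun _ _ => one_pos) fun x y hx hy => by
      have hb : bilinSum (fun _ _ => 1) x y = (∑ i, x i) * ∑ j, y j := by
        simp [bilinSum, Finset.sum_mul_sum]
      rw [hb, mul_pow, one_mul]
      exact mul_le_mul (hle R x hx hRN) (hle C y hy hCN)
        (Finset.prod_nonneg fun j _ => pow_nonneg (hy j).le _)
        (pow_nonneg (Finset.sum_nonneg fun i _ => (hx i).le) _)
  by_contra hne
  rw [Finset.not_nonempty_iff_eq_empty] at hne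
  have hpos := mul_pos (omegaVec_pos hR) (omegaVec_pos hC)
  have : (0 : ℝ) < N.factorial := by positivity
  rw [expTableWeight, hne, Finset.sum_empty, mul_zero, one_mul] at h
  exact absurd h (not_le.2 (mul_pos this hpos))

variable {κ : Type*} [Fintype κ]

theorem sum_eq_of_convexComb {l N : ℕ} {α : κ → ℝ} (hα1 : ∑ k, α k = 1) {B : Fin l → ℕ}
    {Bk : κ → Fin l → ℕ} (hBk : ∀ k, ∑ i, Bk k i = N)
    (hB : ∀ i, (B i : ℝ) = ∑ k, α k * Bk k i) : ∑ i, B i = N := by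
  have h : (∑ i, (B i : ℝ)) = N := by
    have hBk' : ∀ k, ∑ i, (Bk k i : ℝ) = N := fun k => by exact_mod_cast hBk k
    simp_rw [hB]
    rw [Finset.sum_comm]
    simp_rw [← Finset.mul_sum, hBk', ← Finset.sum_mul, hα1, one_mul]
  exact_mod_cast h

theorem prod_rpow_prod_pow {l : ℕ} {α : κ → ℝ} {B : Fin l → ℕ} {Bk : κ → Fin l → ℕ}
    (hB : ∀ i, (B i : ℝ) = ∑ k, α k * Bk k i) {x : Fin l → ℝ} (hx : ∀ i, 0 < x i) :
    ∏ k, (∏ i, x i ^ Bk k i) ^ α k = ∏ i, x i ^ B i := by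
  have h1 : ∀ k, (∏ i, x i ^ Bk k i) ^ α k = ∏ i, x i ^ (α k * Bk k i) := fun k => by
    rw [← Real.finsetProd_rpow _ _ fun i _ => pow_nonneg (hx i).le _]
    refine Finset.prod_congr rfl fun i _ => ?_
    rw [mul_comm, Real.rpow_mul (hx i).le, Real.rpow_natCast]
  simp_rw [h1]
  rw [Finset.prod_comm]
  refine Finset.prod_congr rfl fun i _ => ?_
  rw [← Real.rpow_sum_of_pos (hx i), ← hB, Real.rpow_natCast]

theorem prod_rpow_pow_bilinSum_le {N : ℕ} {α : κ → ℝ} (hα : ∀ k, 0 ≤ α k) (hα1 : ∑ k, α k = 1)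
    {b : κ → Fin m → Fin n → ℝ} (hb : ∀ k i j, 0 ≤ b k i j) {x : Fin m → ℝ} {y : Fin n → ℝ}
    (hx : ∀ i, 0 ≤ x i) (hy : ∀ j, 0 ≤ y j) :
    ∏ k, (bilinSum (b k) x y ^ N) ^ α k
      ≤ bilinSum (fun i j => ∑ k, α k * b k i j) x y ^ N := by
  have hB : ∀ k, 0 ≤ bilinSum (b k) x y := fun k =>
    Finset.sum_nonneg fun i _ => Finset.sum_nonneg fun j _ =>
      mul_nonneg (mul_nonneg (hb k i j) (hx i)) (hy j)
  have h1 : ∏ k, (bilinSum (b k) x y ^ N) ^ α k = (∏ k, bilinSum (b k) x y ^ α k) ^ N := by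
    rw [← Finset.prod_pow]
    refine Finset.prod_congr rfl fun k _ => ?_
    rw [← Real.rpow_natCast, ← Real.rpow_mul (hB k), mul_comm, Real.rpow_mul (hB k),
      Real.rpow_natCast]
  have h2 : bilinSum (fun i j => ∑ k, α k * b k i j) x y = ∑ k, α k * bilinSum (b k) x y := by
    simp only [bilinSum, Finset.mul_sum, Finset.sum_mul]
    rw [Finset.sum_comm' (t' := Finset.univ) (s' := fun _ => Finset.univ) (by simp)]
    conv_rhs => rw [Finset.sum_comm]
    rw [Finset.sum_comm]
    refine Finset.sum_congr rfl fun i _ => ?_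
    rw [Finset.sum_comm]
    exact Finset.sum_congr rfl fun k _ => Finset.sum_congr rfl fun j _ => by ring
  rw [h1, h2]
  exact pow_le_pow_left₀ (Finset.prod_nonneg fun k _ => Real.rpow_nonneg (hB k) _)
    (Real.geom_mean_le_arith_mean_weighted _ _ _ (fun k _ => hα k) hα1 fun k _ => hB k) N

theorem expTableWeight_pos {R : Fin m → ℕ} {C : Fin n → ℕ} (h : (contingencyTables R C).Nonempty)
    {a : Fin m → Fin n → ℝ} (ha : ∀ i j, 0 < a i j) : 0 < expTableWeight R C a :=
  Finset.sum_pos (fun D _ => Finset.prod_pos fun i _ => Finset.prod_pos fun j _ =>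
    div_pos (pow_pos (ha i j) _) (by positivity)) h

theorem prod_rpow_expTableWeight_le {N : ℕ}
    {Rk : κ → Fin m → ℕ} {Ck : κ → Fin n → ℕ}
    (hRkpos : ∀ k i, 0 < Rk k i) (hCkpos : ∀ k j, 0 < Ck k j)
    (hRkN : ∀ k, ∑ i, Rk k i = N) (hCkN : ∀ k, ∑ j, Ck k j = N)
    {α : κ → ℝ} (hα : ∀ k, 0 ≤ α k) (hα1 : ∑ k, α k = 1)
    {R : Fin m → ℕ} {C : Fin n → ℕ} (hRpos : ∀ i, 0 < R i) (hCpos : ∀ j, 0 < C j)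
    (hR : ∀ i, (R i : ℝ) = ∑ k, α k * Rk k i) (hC : ∀ j, (C j : ℝ) = ∑ k, α k * Ck k j)
    {b : κ → Fin m → Fin n → ℝ} (hb : ∀ k i j, 0 < b k i j) :
    ∏ k, (expTableWeight (Rk k) (Ck k) (b k) /
        min (omegaVec (Rk k)) (omegaVec (Ck k))) ^ α k
      ≤ (N : ℝ) ^ N / N.factorial / (omegaVec R * omegaVec C) *
        expTableWeight R C (fun i j => ∑ k, α k * b k i j) := by
  set P := ∏ k, (expTableWeight (Rk k) (Ck k) (b k) /
        min (omegaVec (Rk k)) (omegaVec (Ck k))) ^ α k with hP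
  have hmin : ∀ k, 0 < min (omegaVec (Rk k)) (omegaVec (Ck k)) := fun k =>
    lt_min (omegaVec_pos (hRkpos k)) (omegaVec_pos (hCkpos k))
  have hE : ∀ k, 0 ≤ expTableWeight (Rk k) (Ck k) (b k) /
      min (omegaVec (Rk k)) (omegaVec (Ck k)) := fun k =>
    (div_pos (expTableWeight_pos (contingencyTables_nonempty (hRkpos k) (hCkpos k) (hRkN k)
      (hCkN k)) (hb k)) (hmin k)).le
  have hNN : (0 : ℝ) < (N : ℝ) ^ N := by
    rcases Nat.eq_zero_or_pos N with rfl | h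
    · simp
    · positivity
  have hcap := le_expTableWeight_of_capacity hRpos hCpos (sum_eq_of_convexComb hα1 hRkN hR)
    (sum_eq_of_convexComb hα1 hCkN hC) (a := fun i j => ∑ k, α k * b k i j)
    (A := (N : ℝ) ^ N * P) (fun i j => convexComb_pos hα hα1 fun k => hb k i j)
    fun x y hx hy => by
      refine le_trans (le_of_eq ?_) ((Finset.prod_le_prod (fun k _ => ?_) fun k _ =>
        Real.rpow_le_rpow ?_ (?_ : (N : ℝ) ^ N * (expTableWeight (Rk k) (Ck k) (b k) /
          min (omegaVec (Rk k)) (omegaVec (Ck k))) * ((∏ i, x i ^ Rk k i) * ∏ j, y j ^ Ck k j)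
            ≤ bilinSum (b k) x y ^ N) (hα k)).trans
        (prod_rpow_pow_bilinSum_le hα hα1 (fun k i j => (hb k i j).le) (fun i => (hx i).le)
          fun j => (hy j).le))
      · have hX : ∀ k, 0 ≤ ∏ i, x i ^ Rk k i := fun k =>
          Finset.prod_nonneg fun i _ => pow_nonneg (hx i).le _
        have hY : ∀ k, 0 ≤ ∏ j, y j ^ Ck k j := fun k =>
          Finset.prod_nonneg fun j _ => pow_nonneg (hy j).le _
        have h1 : ∏ k, ((N : ℝ) ^ N) ^ α k = (N : ℝ) ^ N := by
          rw [← Real.rpow_sum_of_pos hNN, hα1, Real.rpow_one]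
        rw [← prod_rpow_prod_pow hR hx, ← prod_rpow_prod_pow hC hy, hP]
        nth_rewrite 1 [← h1]
        rw [← Finset.prod_mul_distrib, ← Finset.prod_mul_distrib, ← Finset.prod_mul_distrib]
        refine Finset.prod_congr rfl fun k _ => ?_
        rw [Real.mul_rpow (mul_nonneg hNN.le (hE k)) (mul_nonneg (hX k) (hY k)),
          Real.mul_rpow hNN.le (hE k), Real.mul_rpow (hX k) (hY k)]
      · exact Real.rpow_nonneg (mul_nonneg (mul_nonneg hNN.le (hE k)) (mul_nonneg
          (Finset.prod_nonneg fun i _ => pow_nonneg (hx i).le _)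
          (Finset.prod_nonneg fun j _ => pow_nonneg (hy j).le _))) _
      · exact mul_nonneg (mul_nonneg hNN.le (hE k)) (mul_nonneg
          (Finset.prod_nonneg fun i _ => pow_nonneg (hx i).le _)
          (Finset.prod_nonneg fun j _ => pow_nonneg (hy j).le _))
      · have h := expTableWeight_le_min_omegaVec (hRkpos k) (hCkpos k) (hRkN k) (hCkN k)
          (fun i j => (hb k i j).le) (fun i => (hx i).le) fun j => (hy j).le
        rw [mul_div_assoc', div_mul_eq_mul_div, div_le_iff₀ (hmin k), mul_comm (bilinSum _ _ _ ^ N)]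
        exact h
  have hω := mul_pos (omegaVec_pos hRpos) (omegaVec_pos hCpos)
  have hfac : (0 : ℝ) < N.factorial := by positivity
  rw [div_div, div_mul_eq_mul_div, le_div_iff₀ (mul_pos hfac hω)]
  refine le_of_mul_le_mul_left ?_ hNN
  calc _ = (N : ℝ) ^ N * P * N.factorial * (omegaVec R * omegaVec C) := by ring
    _ ≤ _ := hcap
    _ = _ := by ring

theorem tableWeight_eq_sum_mul_prod_factorial (R : Fin m → ℕ) (C : Fin n → ℕ)
    (W : Fin m → Fin n → ℝ) (c : ℝ) :
    c * tableWeight R C W = ∑ D ∈ contingencyTables R C,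
      (c * ∏ i, ∏ j, W i j ^ D i j / (D i j).factorial) *
        ∏ q : Fin m × Fin n, ((D q.1 q.2).factorial : ℝ) := by
  rw [tableWeight_eq_sum, Finset.mul_sum]
  refine Finset.sum_congr rfl fun D _ => ?_
  rw [Fintype.prod_prod_type, mul_assoc, ← Finset.prod_mul_distrib]
  congr 1
  refine Finset.prod_congr rfl fun i _ => ?_
  rw [← Finset.prod_mul_distrib]
  exact Finset.prod_congr rfl fun j _ => by field_simp

theorem expTableWeight_mul_eq_sum (R : Fin m → ℕ) (C : Fin n → ℕ)
    (W : Fin m → Fin n → ℝ) (c : ℝ) (g : Fin m × Fin n → ℝ) :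
    c * expTableWeight R C (fun i j => W i j * g (i, j)) = ∑ D ∈ contingencyTables R C,
      (c * ∏ i, ∏ j, W i j ^ D i j / (D i j).factorial) *
        ∏ q : Fin m × Fin n, g q ^ D q.1 q.2 := by
  rw [expTableWeight, Finset.mul_sum]
  refine Finset.sum_congr rfl fun D _ => ?_
  rw [Fintype.prod_prod_type, mul_assoc, ← Finset.prod_mul_distrib]
  congr 1
  refine Finset.prod_congr rfl fun i _ => ?_
  rw [← Finset.prod_mul_distrib]
  exact Finset.prod_congr rfl fun j _ => by rw [mul_pow]; ring

theorem prod_rpow_tableWeight_le_of_pos {N : ℕ} {W : Fin m → Fin n → ℝ} (hW : ∀ i j, 0 < W i j)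
    {Rk : κ → Fin m → ℕ} {Ck : κ → Fin n → ℕ}
    (hRkpos : ∀ k i, 0 < Rk k i) (hCkpos : ∀ k j, 0 < Ck k j)
    (hRkN : ∀ k, ∑ i, Rk k i = N) (hCkN : ∀ k, ∑ j, Ck k j = N)
    {α : κ → ℝ} (hα : ∀ k, 0 ≤ α k) (hα1 : ∑ k, α k = 1)
    {R : Fin m → ℕ} {C : Fin n → ℕ} (hRpos : ∀ i, 0 < R i) (hCpos : ∀ j, 0 < C j)
    (hR : ∀ i, (R i : ℝ) = ∑ k, α k * Rk k i) (hC : ∀ j, (C j : ℝ) = ∑ k, α k * Ck k j) :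
    ∏ k, (tableWeight (Rk k) (Ck k) W / min (omegaVec (Rk k)) (omegaVec (Ck k))) ^ α k
      ≤ (N : ℝ) ^ N / N.factorial / (omegaVec R * omegaVec C) * tableWeight R C W := by
  have hmin : ∀ k, 0 < (min (omegaVec (Rk k)) (omegaVec (Ck k)))⁻¹ := fun k =>
    inv_pos.2 (lt_min (omegaVec_pos (hRkpos k)) (omegaVec_pos (hCkpos k)))
  have hω := mul_pos (omegaVec_pos hRpos) (omegaVec_pos hCpos)
  have hw : ∀ D : Fin m → Fin n → ℕ, 0 < ∏ i, ∏ j, W i j ^ D i j / (D i j).factorial := fun D =>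
    Finset.prod_pos fun i _ => Finset.prod_pos fun j _ =>
      div_pos (pow_pos (hW i j) _) (by positivity)
  simp_rw [div_eq_inv_mul (tableWeight _ _ _), tableWeight_eq_sum_mul_prod_factorial]
  refine prekopa_leindler_prod_factorial hα hα1
    (fun (D : Fin m → Fin n → ℕ) (q : Fin m × Fin n) => D q.1 q.2)
    (fun D _ => mul_nonneg (by positivity) (hw D).le)
    (fun k => contingencyTables_nonempty (hRkpos k) (hCkpos k) (hRkN k) (hCkN k))
    (fun k D _ => mul_pos (hmin k) (hw D)) fun γ hγ => ?_
  simp_rw [← expTableWeight_mul_eq_sum]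
  have h := prod_rpow_expTableWeight_le hRkpos hCkpos hRkN hCkN hα hα1 hRpos hCpos hR hC
    (b := fun k i j => W i j * γ k (i, j)) fun k i j => mul_pos (hW i j) (hγ k (i, j))
  simp_rw [div_eq_inv_mul (expTableWeight _ _ _)] at h
  refine h.trans_eq ?_
  congr 2
  funext i j
  rw [Finset.mul_sum]
  exact Finset.sum_congr rfl fun k _ => by ring

theorem continuous_tableWeight_add (R : Fin m → ℕ) (C : Fin n → ℕ) (W : Fin m → Fin n → ℝ) :
    Continuous fun ε : ℝ => tableWeight R C fun i j => W i j + ε := by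
  simp_rw [tableWeight_eq_sum]
  fun_prop

end BrunnMinkowski

theorem brunn_minkowski_contingency {m n p N : ℕ}
    (W : Fin m → Fin n → ℝ) (hW : ∀ i j, 0 ≤ W i j)
    (Rk : Fin p → Fin m → ℕ) (Ck : Fin p → Fin n → ℕ)
    (hRkpos : ∀ k i, 0 < Rk k i) (hCkpos : ∀ k j, 0 < Ck k j)
    (hRkN : ∀ k, ∑ i, Rk k i = N) (hCkN : ∀ k, ∑ j, Ck k j = N)
    (α : Fin p → ℝ) (hα : ∀ k, 0 ≤ α k) (hα1 : ∑ k, α k = 1)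
    (R : Fin m → ℕ) (C : Fin n → ℕ)
    (hRpos : ∀ i, 0 < R i) (hCpos : ∀ j, 0 < C j)
    (hR : ∀ i, (R i : ℝ) = ∑ k, α k * Rk k i)
    (hC : ∀ j, (C j : ℝ) = ∑ k, α k * Ck k j) :
    ((N : ℝ) ^ N / (Nat.factorial N : ℝ)) *
        tableWeight R C W / (omegaVec R * omegaVec C) ≥
      ∏ k, (tableWeight (Rk k) (Ck k) W /
        min (omegaVec (Rk k)) (omegaVec (Ck k))) ^ (α k) := by
  have hleft : Continuous fun ε : ℝ => ∏ k, (tableWeight (Rk k) (Ck k) (fun i j => W i j + ε) /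
      min (omegaVec (Rk k)) (omegaVec (Ck k))) ^ α k :=
    continuous_finsetProd _ fun k _ =>
      ((continuous_tableWeight_add _ _ W).div_const _).rpow_const fun _ => Or.inr (hα k)
  have hright := (continuous_tableWeight_add R C W).const_mul
    ((N : ℝ) ^ N / N.factorial / (omegaVec R * omegaVec C))
  have h := le_of_tendsto_of_tendsto
    ((hleft.tendsto 0).mono_left (nhdsWithin_le_nhds (s := Set.Ioi 0)))
    ((hright.tendsto 0).mono_left nhdsWithin_le_nhds)
    (Filter.eventually_of_mem self_mem_nhdsWithin fun ε hε =>
      prod_rpow_tableWeight_le_of_pos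
        (fun i j => add_pos_of_nonneg_of_pos (hW i j) hε) hRkpos hCkpos hRkN hCkN hα hα1
        hRpos hCpos hR hC)
  simp only [add_zero] at h
  rw [ge_iff_le, mul_div_right_comm]
  exact h
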